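/- arXiv:2110.13019 — 2 statements merged into one kernel-verified Lean document; each statement's English description precedes it below -/
import Mathlib

section
/- In the matrix Charlier setting with general parameters, fix λ ∈ ℕ₀ and suppose there exist real numbers d ≠ 0 and c such that δ_i^{(λ+1)}/δ_i^{(λ)} − δ_{i+1}^{(λ+1)}/δ_{i+1}^{(λ)} = −da/2 for i = 1,…,N−1, and (μ_i/μ_{i−1})²·(δ_{i−1}^{(λ+1)}/δ_i^{(λ)}) − (μ_{i+1}/μ_i)²·(δ_i^{(λ+1)}/δ_{i+1}^{(λ)}) = d·i + c for i = 1,…,N, where the first summand is omitted (taken to be 0) when i = 1 and the second when i = N. Let J = diag(1,…,N) and define K_2 = −(d/2)·A^*(I+A^*)^{−1}, K_1 = (d/2)·(2J − aA^* − (2λ+1)A^*(I+A^*)^{−1}) + c·I, K_0 = (I+A^*)^{−λ}(T^{(λ)})^{−1}(I+A)T^{(λ+1)}(I+A^*)^{λ+1}, J_1 = K_2 + K_1 − (1/a)(I+A^*)^{−λ−1}(T^{(λ)})^{−1}T^{(λ+1)}(I+A^*)^{λ+1}, and J_0 = K_0. Then for all x ∈ ℤ, W^{(λ+1)}(x) =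 W^{(λ)}(x)·(x²K_2 + xK_1 + K_0) and W^{(λ+1)}(x) − W^{(λ+1)}(x−1) = W^{(λ)}(x)·(xJ_1 + J_0); that is, the pair (W^{(λ)}, W^{(λ+1)}) satisfies strong Pearson equations with a matrix polynomial Φ^{(λ)} of degree at most two and Ψ^{(λ)} of degree at most one. -/
open scoped BigOperators ComplexOrder
open Matrix Polynomial

noncomputable section

/-- The space of `N × N` complex matrices, with rows and columns indexed by `Fin N`
(the index `j : Fin N` corresponds to the row/column `j+1 ∈ {1,…,N}` of the paper). -/
abbrev Mat (N : ℕ) := Matrix (Fin N) (Fin N) ℂ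

/-- Evaluation of a matrix polynomial at a (scalar) complex number. -/
def matEval {N : ℕ} (P : Polynomial (Mat N)) (z : ℂ) : Mat N :=
  P.eval (z • (1 : Mat N))

/-- The scalar Charlier polynomial
`c_n^{(a)}(x) = ∑_{k=0}^n ((-n)_k (-x)_k / k!) (-1/a)^k`. -/
def charlier (a : ℂ) (n : ℕ) (x : ℂ) : ℂ :=
  ∑ k ∈ Finset.range (n + 1),
    (ascPochhammer ℂ k).eval (-(n : ℂ)) * (ascPochhammer ℂ k).eval (-x)
      / (k.factorial : ℂ) * (-(1 / a)) ^ k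

/-- The nilpotent matrix `A` with `A_{j+1,j} = μ_{j+1}/μ_j` (paper indices `1,…,N`). -/
def Amat (N : ℕ) (μ : ℕ → ℝ) : Mat N :=
  Matrix.of fun j k : Fin N =>
    if (j : ℕ) = (k : ℕ) + 1 then ((μ ((j : ℕ) + 1) / μ ((k : ℕ) + 1) : ℝ) : ℂ) else 0

/-- The diagonal matrix `T = diag(δ_1,…,δ_N)`. -/
def Tmat (N : ℕ) (δ : ℕ → ℝ) : Mat N :=
  Matrix.diagonal fun k : Fin N => ((δ ((k : ℕ) + 1) : ℝ) : ℂ)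

/-- The matrix Charlier weight
`W^{(λ)}(x) = (a^x/x!) (I+A)^{x+λ} T^{(λ)} (I+A^*)^{x+λ}`. -/
def Wch (N : ℕ) (a : ℝ) (μ δ : ℕ → ℝ) (lam x : ℕ) : Mat N :=
  ((a ^ x / x.factorial : ℝ) : ℂ) •
    ((1 + Amat N μ) ^ (x + lam) * Tmat N δ * (1 + (Amat N μ)ᴴ) ^ (x + lam))

/-- The unipotent lower triangular matrix `L(x)` with entries
`L(x)_{j,k} = (μ_j/μ_k)(-a)^{j-k} c_{j-k}^{(a)}(x)/(j-k)!` for `j ≥ k`. -/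
def Lmat (N : ℕ) (a : ℝ) (μ : ℕ → ℝ) (z : ℂ) : Mat N :=
  Matrix.of fun j k : Fin N =>
    if (k : ℕ) ≤ (j : ℕ) then
      ((μ ((j : ℕ) + 1) / μ ((k : ℕ) + 1) : ℝ) : ℂ) * (-(a : ℂ)) ^ ((j : ℕ) - (k : ℕ))
        * charlier (a : ℂ) ((j : ℕ) - (k : ℕ)) z / ((((j : ℕ) - (k : ℕ)).factorial) : ℂ)
    else 0

/-- Matrix-valued inner product for a weight supported on `ℕ₀`. -/
def innerN {N : ℕ} (W : ℕ → Mat N) (P Q : Polynomial (Mat N)) : Mat N :=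
  ∑' x : ℕ, matEval P x * W x * (matEval Q x)ᴴ

/-- `P` is the monic orthogonal sequence of the weight `W` supported on `ℕ₀`. -/
structure IsMOSN {N : ℕ} (W : ℕ → Mat N) (P : ℕ → Polynomial (Mat N)) : Prop where
  monic : ∀ n, (P n).Monic
  deg : ∀ n, (P n).natDegree = n
  orth : ∀ m n, m ≠ n → innerN W (P m) (P n) = 0

/-- The diagonal matrix `J = diag(1,2,…,N)`. -/
def Jdiag (N : ℕ) : Mat N := Matrix.diagonal fun j : Fin N => ((j : ℕ) + 1 : ℂ)

/-- The matrix Charlier weight extended by zero to the negative integers. -/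
def WchZ (N : ℕ) (a : ℝ) (μ δ : ℕ → ℝ) (lam : ℕ) (x : ℤ) : Mat N :=
  if 0 ≤ x then Wch N a μ δ lam x.toNat else 0

/-- The coefficient `K₂ = -(d/2) A^*(I+A^*)⁻¹`. -/
def K2m (N : ℕ) (μ : ℕ → ℝ) (d : ℝ) : Mat N :=
  -(((d / 2 : ℝ) : ℂ) • ((Amat N μ)ᴴ * (1 + (Amat N μ)ᴴ)⁻¹))

/-- The coefficient `K₁ = (d/2)(2J - aA^* - (2λ+1)A^*(I+A^*)⁻¹) + c·I`. -/
def K1m (N : ℕ) (μ : ℕ → ℝ) (a d c : ℝ) (lam : ℕ) : Mat N :=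
  ((d / 2 : ℝ) : ℂ) • ((2 : ℂ) • Jdiag N - (a : ℂ) • (Amat N μ)ᴴ
      - ((2 * (lam : ℂ) + 1)) • ((Amat N μ)ᴴ * (1 + (Amat N μ)ᴴ)⁻¹))
    + (c : ℂ) • (1 : Mat N)

/-- The coefficient `K₀ = (I+A^*)^{-λ}(T^{(λ)})⁻¹(I+A)T^{(λ+1)}(I+A^*)^{λ+1}`. -/
def K0m (N : ℕ) (μ : ℕ → ℝ) (δ : ℕ → ℕ → ℝ) (lam : ℕ) : Mat N :=
  ((1 + (Amat N μ)ᴴ) ^ lam)⁻¹ * (Tmat N (δ lam))⁻¹ * (1 + Amat N μ)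
    * Tmat N (δ (lam + 1)) * (1 + (Amat N μ)ᴴ) ^ (lam + 1)

/-- The coefficient `J₁ = K₂ + K₁ - (1/a)(I+A^*)^{-λ-1}(T^{(λ)})⁻¹T^{(λ+1)}(I+A^*)^{λ+1}`. -/
def J1m (N : ℕ) (μ : ℕ → ℝ) (δ : ℕ → ℕ → ℝ) (a d c : ℝ) (lam : ℕ) : Mat N :=
  K2m N μ d + K1m N μ a d c lam
    - ((1 / a : ℝ) : ℂ) • (((1 + (Amat N μ)ᴴ) ^ (lam + 1))⁻¹ * (Tmat N (δ lam))⁻¹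
        * Tmat N (δ (lam + 1)) * (1 + (Amat N μ)ᴴ) ^ (lam + 1))

lemma Tmat_mul_Tmat_inv {N : ℕ} {δ : ℕ → ℝ} (hδ : ∀ k, 1 ≤ k → k ≤ N → 0 < δ k) :
    Tmat N δ * Tmat N (fun k => (δ k)⁻¹) = 1 := by
  simp only [Tmat, diagonal_mul_diagonal]
  rw [← diagonal_one]
  congr 1
  funext k
  have h : ((δ ((k : ℕ) + 1) : ℝ) : ℂ) ≠ 0 :=
    Complex.ofReal_ne_zero.2 (hδ _ (by omega) (by omega)).ne'
  push_cast
  exact mul_inv_cancel₀ h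

lemma det_one_add_conjTranspose_Amat (N : ℕ) (μ : ℕ → ℝ) :
    (1 + (Amat N μ)ᴴ).det = 1 := by
  rw [det_of_isUpperTriangular]
  · refine Finset.prod_eq_one fun i _ => ?_
    simp [Amat, conjTranspose_apply]
  · intro i j hij
    have hij' : j < i := hij
    have h1 : i ≠ j := hij'.ne'
    have h2 : ¬ ((j : ℕ) = (i : ℕ) + 1) := by
      have : (j : ℕ) < i := hij'
      omega
    simp [Amat, conjTranspose_apply, h1, h2]

lemma Tmat_mul_Tmat (N : ℕ) (s t : ℕ → ℝ) :
    Tmat N s * Tmat N t = Tmat N fun k => s k * t k := by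
  simp [Tmat, diagonal_mul_diagonal]

/-- A diagonal matrix whose consecutive entries differ by a constant commutes with `A^*` up to a
multiple of `A^*`. -/
lemma Tmat_mul_conjTranspose_Amat {N : ℕ} (μ s : ℕ → ℝ) (r : ℝ)
    (h : ∀ i, 1 ≤ i → i ≤ N - 1 → s i - s (i + 1) = r) :
    Tmat N s * (Amat N μ)ᴴ = (Amat N μ)ᴴ * Tmat N s + (r : ℂ) • (Amat N μ)ᴴ := by
  ext i j
  simp only [Tmat, diagonal_mul, mul_diagonal, Matrix.add_apply, Matrix.smul_apply, smul_eq_mul,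
    conjTranspose_apply, Amat, of_apply]
  split_ifs with hij
  · have h' := h ((i : ℕ) + 1) (by omega) (by omega)
    rw [hij, ← h']
    push_cast
    ring
  · simp

lemma Jdiag_eq_Tmat (N : ℕ) : Jdiag N = Tmat N fun k => (k : ℝ) := by
  simp [Jdiag, Tmat]

lemma Amat_mul_Tmat_mul_conjTranspose (N : ℕ) (μ s : ℕ → ℝ) :
    Amat N μ * Tmat N s * (Amat N μ)ᴴ
      = Tmat N fun i => if i = 1 then 0 else (μ i / μ (i - 1)) ^ 2 * s (i - 1) := by
  ext i j
  rw [mul_apply]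
  simp only [Tmat, mul_diagonal, conjTranspose_apply, Amat, of_apply]
  rcases i with ⟨_ | i, hi⟩
  · simp [diagonal_apply]
  · rw [Finset.sum_eq_single (⟨i, by omega⟩ : Fin N)]
    · rcases j with ⟨j, hj⟩
      by_cases hij : j = i + 1
      · subst hij
        simp
        ring
      · simp [hij, Ne.symm hij]
    · intro k _ hk
      have : i ≠ (k : ℕ) := fun e => hk (Fin.ext e.symm)
      simp [this]
    · simp

lemma conjTranspose_Amat_mul_Tmat_mul (N : ℕ) (μ s : ℕ → ℝ) :
    (Amat N μ)ᴴ * Tmat N s * Amat N μ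
      = Tmat N fun i => if i = N then 0 else (μ (i + 1) / μ i) ^ 2 * s (i + 1) := by
  ext i j
  rw [mul_apply]
  simp only [Tmat, mul_diagonal, conjTranspose_apply, Amat, of_apply]
  by_cases hN : (i : ℕ) + 1 = N
  · rw [Finset.sum_eq_zero]
    · simp [diagonal_apply, hN]
    · intro k _
      have : ¬ ((k : ℕ) = (i : ℕ) + 1) := by omega
      simp [this]
  · rw [Finset.sum_eq_single (⟨i + 1, by omega⟩ : Fin N)]
    · by_cases hij : i = j
      · subst hij
        simp [hN]
        ring
      · have : ¬ ((i : ℕ) = j) := fun e => hij (Fin.ext e)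
        simp [hij, this]
    · intro k _ hk
      have : ¬ ((k : ℕ) = (i : ℕ) + 1) := fun e => hk (Fin.ext (by simp; omega))
      simp [this]
    · simp

/-- If `P` commutes with `U = I + B` up to a multiple of `B`, then it commutes with `U ^ m` up to
the corresponding multiple of `B U⁻¹`. -/
lemma mul_one_add_pow_of_mul_eq {N : ℕ} {B P : Mat N} (hU : IsUnit (1 + B).det) {r : ℂ}
    (h : P * B = B * P + r • B) (m : ℕ) :
    P * (1 + B) ^ m = (1 + B) ^ m * (P + (m * r) • (B * (1 + B)⁻¹)) := by
  induction m with
  | zero => simp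
  | succ m ih =>
    have hEU : B * (1 + B)⁻¹ * (1 + B) = B := by
      rw [mul_assoc, nonsing_inv_mul _ hU, mul_one]
    have hUE : (1 + B) * (B * (1 + B)⁻¹) = B := by
      have hc : (1 + B) * B = B * (1 + B) := by noncomm_ring
      rw [← mul_assoc, hc, mul_assoc, mul_nonsing_inv _ hU, mul_one]
    have hPU : P * (1 + B) = (1 + B) * P + r • B := by
      rw [mul_add, h]
      noncomm_ring
    rw [pow_succ, ← mul_assoc, ih, mul_assoc, mul_assoc]
    congr 1
    rw [add_mul, smul_mul_assoc, hEU, hPU, mul_add, mul_smul_comm, hUE]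
    push_cast
    module

/-- The quadratic polynomial in `x` obtained by conjugating `M` with powers of `I + B`. -/
lemma mul_one_add_pow_succ_eq_quadratic {N : ℕ} {B M J : Mat N} (hU : IsUnit (1 + B).det)
    {a d c : ℂ} (hJ : J * B = B * J + (-1 : ℂ) • B)
    (hM : M * B = B * M + (-(d * a / 2)) • B + d • J + c • (1 : Mat N)) (l x : ℕ) :
    M * (1 + B) ^ (x + l + 1) = (1 + B) ^ (x + l) *
      ((x : ℂ) ^ 2 • (-((d / 2) • (B * (1 + B)⁻¹)))
        + (x : ℂ) • ((d / 2) • ((2 : ℂ) • J - a • B - (2 * (l : ℂ) + 1) • (B * (1 + B)⁻¹))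
          + c • (1 : Mat N))
        + ((1 + B) ^ l)⁻¹ * M * (1 + B) ^ (l + 1)) := by
  have hl : IsUnit ((1 + B) ^ l).det := by rw [det_pow]; exact hU.pow l
  have hK : M * (1 + B) ^ (l + 1)
      = (1 + B) ^ l * (((1 + B) ^ l)⁻¹ * M * (1 + B) ^ (l + 1)) := by
    simp only [← mul_assoc, mul_nonsing_inv _ hl, one_mul]
  have hJU := mul_one_add_pow_of_mul_eq hU hJ
  generalize ((1 + B) ^ l)⁻¹ * M * (1 + B) ^ (l + 1) = K at *
  generalize B * (1 + B)⁻¹ = E at *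
  induction x with
  | zero => simpa using hK
  | succ x ih =>
    have hMU : M * (1 + B)
        = (1 + B) * M + ((-(d * a / 2)) • B + d • J + c • (1 : Mat N)) := by
      rw [mul_add, hM]
      noncomm_ring
    have hB : B * (1 + B) ^ (x + l + 1) = (1 + B) ^ (x + l + 1) * B :=
      ((Commute.one_right B).add_right (Commute.refl B)).pow_right _
    have e : x + 1 + l = x + l + 1 := by omega
    rw [e, pow_succ' _ (x + l + 1), ← mul_assoc, hMU, add_mul, mul_assoc, ih, ← mul_assoc,
      ← pow_succ', add_mul, add_mul, smul_mul_assoc, smul_mul_assoc, smul_mul_assoc, hB,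
      hJU, one_mul]
    simp only [← mul_smul_comm, ← mul_add]
    have hone : c • (1 + B) ^ (x + l + 1) = (1 + B) ^ (x + l + 1) * (c • (1 : Mat N)) := by simp
    rw [hone]
    simp only [← mul_add]
    congr 1
    push_cast
    module

/-- under the nonlinear conditions on the parameters, the matrix
Charlier weights satisfy strong Pearson equations with `Φ` of degree at most two
and `Ψ` of degree at most one. -/
theorem charlier_strong_pearson (N : ℕ) (hN : 1 ≤ N) (a : ℝ) (ha : 0 < a)
    (μ : ℕ → ℝ) (hμ : ∀ j : ℕ, 1 ≤ j → j ≤ N → 0 < μ j)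
    (δ : ℕ → ℕ → ℝ) (hδ : ∀ lam k : ℕ, 1 ≤ k → k ≤ N → 0 < δ lam k)
    (lam : ℕ) (d c : ℝ) (hd : d ≠ 0)
    (heq1 : ∀ i : ℕ, 1 ≤ i → i ≤ N - 1 →
      δ (lam + 1) i / δ lam i - δ (lam + 1) (i + 1) / δ lam (i + 1) = -(d * a) / 2)
    (heq2 : ∀ i : ℕ, 1 ≤ i → i ≤ N →
      (if i = 1 then 0 else (μ i / μ (i - 1)) ^ 2 * (δ (lam + 1) (i - 1) / δ lam i))
          - (if i = N then 0
              else (μ (i + 1) / μ i) ^ 2 * (δ (lam + 1) i / δ lam (i + 1)))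
        = d * i + c) :
    ∀ x : ℤ,
      WchZ N a μ (δ (lam + 1)) (lam + 1) x
        = WchZ N a μ (δ lam) lam x
            * ((x : ℂ) ^ 2 • K2m N μ d + (x : ℂ) • K1m N μ a d c lam
                + K0m N μ δ lam) ∧
      WchZ N a μ (δ (lam + 1)) (lam + 1) x - WchZ N a μ (δ (lam + 1)) (lam + 1) (x - 1)
        = WchZ N a μ (δ lam) lam x
            * ((x : ℂ) • J1m N μ δ a d c lam + K0m N μ δ lam) := by
  have hU : IsUnit (1 + (Amat N μ)ᴴ).det := by
    rw [det_one_add_conjTranspose_Amat]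
    exact isUnit_one
  have hTT := Tmat_mul_Tmat_inv (hδ lam)
  have hTinv : (Tmat N (δ lam))⁻¹ = Tmat N fun k => (δ lam k)⁻¹ := inv_eq_right_inv hTT
  have hD : Tmat N (fun k => (δ lam k)⁻¹) * Tmat N (δ (lam + 1))
      = Tmat N fun k => δ (lam + 1) k / δ lam k := by
    rw [Tmat_mul_Tmat]
    congr 1
    funext k
    ring
  have hDB := Tmat_mul_conjTranspose_Amat μ (fun k => δ (lam + 1) k / δ lam k) _ heq1
  have hJB := Tmat_mul_conjTranspose_Amat (N := N) μ (fun k => (k : ℝ)) (-1)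
    (fun i _ _ => by push_cast; ring)
  rw [← Jdiag_eq_Tmat] at hJB
  rw [← hD] at hDB
  have hG : Tmat N (fun k => (δ lam k)⁻¹) * Amat N μ * Tmat N (δ (lam + 1)) * (Amat N μ)ᴴ
      = (Amat N μ)ᴴ * (Tmat N (fun k => (δ lam k)⁻¹) * Amat N μ * Tmat N (δ (lam + 1)))
        + (d : ℂ) • Jdiag N + (c : ℂ) • (1 : Mat N) := by
    have h1 := Amat_mul_Tmat_mul_conjTranspose N μ (δ (lam + 1))
    have h2 := conjTranspose_Amat_mul_Tmat_mul N μ (fun k => (δ lam k)⁻¹)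
    have l1 : Tmat N (fun k => (δ lam k)⁻¹) * Amat N μ * Tmat N (δ (lam + 1)) * (Amat N μ)ᴴ
        = Tmat N (fun k => (δ lam k)⁻¹) * (Amat N μ * Tmat N (δ (lam + 1)) * (Amat N μ)ᴴ) := by
      simp only [mul_assoc]
    have l2 : (Amat N μ)ᴴ * (Tmat N (fun k => (δ lam k)⁻¹) * Amat N μ * Tmat N (δ (lam + 1)))
        = (Amat N μ)ᴴ * Tmat N (fun k => (δ lam k)⁻¹) * Amat N μ * Tmat N (δ (lam + 1)) := by
      simp only [mul_assoc]
    rw [l1, l2, h1, h2, Tmat_mul_Tmat, Tmat_mul_Tmat, Jdiag, Tmat, Tmat, ← diagonal_one,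
      ← diagonal_smul, ← diagonal_smul, diagonal_add, diagonal_add]
    congr 1
    funext i
    have h := heq2 ((i : ℕ) + 1) (by omega) (by omega)
    have h' := congrArg (fun r : ℝ => (r : ℂ)) h
    simp only [Pi.smul_apply, smul_eq_mul, mul_one]
    split_ifs at h' ⊢ <;> push_cast at h' ⊢ <;> linear_combination h'
  simp only [K0m, J1m, K1m, K2m, hTinv]
  simp only [WchZ, Wch]
  generalize (Amat N μ)ᴴ = B at *
  generalize Amat N μ = A at *
  generalize Tmat N (fun k => (δ lam k)⁻¹) = R at *
  generalize Tmat N (δ lam) = T at *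
  generalize Tmat N (δ (lam + 1)) = S at *
  generalize Jdiag N = J at *
  have hM : (R * (1 + A) * S) * B = B * (R * (1 + A) * S) + (-((d : ℂ) * a / 2)) • B
      + (d : ℂ) • J + (c : ℂ) • (1 : Mat N) := by
    have e : R * (1 + A) * S = R * S + R * A * S := by noncomm_ring
    rw [e, add_mul, hDB, hG, mul_add]
    push_cast
    module
  have hquad := mul_one_add_pow_succ_eq_quadratic hU (a := a) (d := d) (c := c)
    (by simpa using hJB) hM lam
  have hlin := mul_one_add_pow_of_mul_eq hU hDB
  have hcancel : ∀ m, T * (R * S * (1 + B) ^ m) = S * (1 + B) ^ m := by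
    intro m
    rw [← mul_assoc, ← mul_assoc, hTT, one_mul]
  have hl1 : IsUnit ((1 + B) ^ (lam + 1)).det := by rw [det_pow]; exact hU.pow _
  have hconj : ((1 + B) ^ (lam + 1))⁻¹ * R * S * (1 + B) ^ (lam + 1)
      = R * S + ((lam + 1 : ℕ) * ((-(d * a) / 2 : ℝ) : ℂ)) • (B * (1 + B)⁻¹) := by
    rw [mul_assoc _ R S, mul_assoc, hlin, ← mul_assoc, nonsing_inv_mul _ hl1, one_mul]
  intro x
  have hass : (((1 + B) ^ lam)⁻¹ * R * (1 + A) * S * (1 + B) ^ (lam + 1))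
      = (((1 + B) ^ lam)⁻¹ * (R * (1 + A) * S) * (1 + B) ^ (lam + 1)) := by
    simp only [mul_assoc]
  rw [hass, hconj]
  generalize ((1 + B) ^ lam)⁻¹ * (R * (1 + A) * S) * (1 + B) ^ (lam + 1) = K at *
  generalize B * (1 + B)⁻¹ = E at *
  rcases lt_or_ge x 0 with hx | hx
  · simp [not_le.2 hx, show ¬ (1 ≤ x) by omega]
  lift x to ℕ using hx
  have hfirst : (1 + A) ^ (x + (lam + 1)) * S * (1 + B) ^ (x + (lam + 1))
      = (1 + A) ^ (x + lam) * T * ((R * (1 + A) * S) * (1 + B) ^ (x + lam + 1)) := by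
    have : T * ((R * (1 + A) * S) * (1 + B) ^ (x + lam + 1))
        = (1 + A) * S * (1 + B) ^ (x + lam + 1) := by
      simp only [← mul_assoc]
      rw [hTT, one_mul]
    rw [mul_assoc _ T, this, ← add_assoc, pow_succ (1 + A)]
    simp only [mul_assoc]
  have hprev : (1 + A) ^ (x + lam) * S * (1 + B) ^ (x + lam)
      = (1 + A) ^ (x + lam) * T * (R * S * (1 + B) ^ (x + lam)) := by
    rw [mul_assoc _ T, hcancel, mul_assoc]
  have key : ∀ X : Mat N, (1 + A) ^ (x + lam) * T * ((1 + B) ^ (x + lam) * X)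
      = (1 + A) ^ (x + lam) * T * (1 + B) ^ (x + lam) * X := fun X => (mul_assoc _ _ _).symm
  constructor
  · simp only [Int.natCast_nonneg, if_true, Int.toNat_natCast, Int.cast_natCast]
    rw [hfirst, hquad, key, smul_mul_assoc]
    push_cast
    rfl
  · have hp : (if 0 ≤ (x : ℤ) - 1 then
          ((a ^ ((x : ℤ) - 1).toNat / (((x : ℤ) - 1).toNat).factorial : ℝ) : ℂ) •
            ((1 + A) ^ (((x : ℤ) - 1).toNat + (lam + 1)) * S
              * (1 + B) ^ (((x : ℤ) - 1).toNat + (lam + 1))) else 0)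
        = (((a ^ x / x.factorial : ℝ) : ℂ) * (x / a)) •
          ((1 + A) ^ (x + lam) * S * (1 + B) ^ (x + lam)) := by
      rcases x with _ | y
      · simp
      · have e : (((y + 1 : ℕ) : ℤ) - 1) = (y : ℤ) := by push_cast; ring
        rw [e, if_pos (Int.natCast_nonneg y), Int.toNat_natCast,
          show y + (lam + 1) = y + 1 + lam by omega]
        congr 1
        have ha' : (a : ℂ) ≠ 0 := Complex.ofReal_ne_zero.2 ha.ne'
        have hf : (y.factorial : ℂ) ≠ 0 := by exact_mod_cast y.factorial_ne_zero
        have hy : (y : ℂ) + 1 ≠ 0 := by exact_mod_cast y.succ_ne_zero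
        rw [Nat.factorial_succ]
        push_cast
        field_simp
        ring
    rw [hp]
    simp only [Int.natCast_nonneg, if_true, Int.toNat_natCast, Int.cast_natCast]
    rw [hfirst, hprev, hquad, hlin, key, key, smul_mul_assoc, mul_smul, ← smul_sub,
      ← mul_smul_comm, ← mul_sub]
    congr 2
    have ha' : (a : ℂ) ≠ 0 := Complex.ofReal_ne_zero.2 ha.ne'
    push_cast
    match_scalars <;> field_simp <;> ring
end
end

section
/- In the matrix Charlier setting with the specific parameters, let (P_n^{(λ)}) be the monic orthogonal sequence of W^{(λ)} with squared norms H_n^{(λ)} = ∑_{x=0}^∞ P_n^{(λ)}(x)W^{(λ)}(x)P_n^{(λ)}(x)^*. Then for all n, λ ∈ ℕ₀, H_n^{(λ)} = L_0^{−1}·(I+A)^{n+λ}·D_n^{(λ)}·(I+A^*)^{n+λ}·(L_0^*)^{−1}, where D_n^{(λ)} is the diagonal matrix with entries (D_n^{(λ)})_{jj} = (−1)^j·e^a·n!·a^n·(a/2)^λ·((λ+N−j)!/(j−1)!)·(−N−λ−n)_j/(λ+n+1)_{N−j+1} for j = 1,…,N. -/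
open scoped BigOperators ComplexOrder
open Matrix Polynomial

noncomputable section

/-- The specific parameters `μ_j = a^{-j/2}/√((N-j)!)`. -/
def μch (N : ℕ) (a : ℝ) (j : ℕ) : ℝ :=
  (Real.sqrt a ^ j * Real.sqrt ((N - j).factorial))⁻¹

/-- The specific parameters `δ_k^{(λ)} = (a/2)^λ (λ+k-1)!/(k-1)!`. -/
def δch (a : ℝ) (lam k : ℕ) : ℝ :=
  (a / 2) ^ lam * ((lam + k - 1).factorial : ℝ) / ((k - 1).factorial : ℝ)

/-- The diagonal matrix `D_n^{(λ)}` with entries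
`(-1)^j e^a n! a^n (a/2)^λ ((λ+N-j)!/(j-1)!) (-N-λ-n)_j/(λ+n+1)_{N-j+1}`
(paper index `j ∈ {1,…,N}`). -/
def Dch (N : ℕ) (a : ℝ) (n lam : ℕ) : Mat N :=
  Matrix.diagonal fun j : Fin N =>
    (-1 : ℂ) ^ ((j : ℕ) + 1) * Complex.exp (a : ℂ) * (n.factorial : ℂ) * (a : ℂ) ^ n
      * ((a : ℂ) / 2) ^ lam * (((lam + (N - ((j : ℕ) + 1))).factorial) : ℂ)
      / (((j : ℕ).factorial) : ℂ)
      * (ascPochhammer ℂ ((j : ℕ) + 1)).eval (-((N : ℂ) + (lam : ℂ) + (n : ℂ)))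
      / (ascPochhammer ℂ (N - (j : ℕ))).eval ((lam : ℂ) + (n : ℂ) + 1)

/-- The matrix `𝒜_ν = (N+ν-J)⁻¹ J A^*`. -/
def Acal (N : ℕ) (a : ℝ) (ν : ℕ) : Mat N :=
  (((N : ℂ) + (ν : ℂ)) • (1 : Mat N) - Jdiag N)⁻¹ * (Jdiag N * (Amat N (μch N a))ᴴ)

section MatrixOrthogonalPolynomials

variable {N : ℕ}

theorem matEval_add (P Q : Polynomial (Mat N)) (z : ℂ) :
    matEval (P + Q) z = matEval P z + matEval Q z := by
  simp [matEval]

theorem matEval_sub (P Q : Polynomial (Mat N)) (z : ℂ) :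
    matEval (P - Q) z = matEval P z - matEval Q z := by
  simp [matEval]

theorem matEval_C_mul (M : Mat N) (Q : Polynomial (Mat N)) (z : ℂ) :
    matEval (C M * Q) z = M * matEval Q z := by
  simp [matEval]

theorem matEval_mul (P Q : Polynomial (Mat N)) (z : ℂ) :
    matEval (P * Q) z = matEval P z * matEval Q z := by
  unfold matEval Polynomial.eval
  exact eval₂_mul_noncomm _ _ fun k => (Commute.one_right _).smul_right z

theorem matEval_C (M : Mat N) (z : ℂ) : matEval (C M) z = M := by
  simp [matEval]

theorem matEval_X (z : ℂ) : matEval (X : Polynomial (Mat N)) z = z • 1 := by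
  simp [matEval]

theorem matEval_sum {ι : Type*} (s : Finset ι) (f : ι → Polynomial (Mat N)) (z : ℂ) :
    matEval (∑ i ∈ s, f i) z = ∑ i ∈ s, matEval (f i) z := by
  simp [matEval, eval_finsetSum]

theorem matEval_pow (P : Polynomial (Mat N)) (k : ℕ) (z : ℂ) :
    matEval (P ^ k) z = matEval P z ^ k := by
  induction k with
  | zero => simp [matEval]
  | succ k ih => rw [pow_succ, pow_succ, matEval_mul, ih]

/-- The polynomial `(X + r)^i - X^i` has degree below `i`. -/
theorem coeff_X_add_C_pow_sub_X_pow (r : Mat N) (i k : ℕ) (h : i ≤ k) :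
    ((X + C r) ^ i - X ^ i : Polynomial (Mat N)).coeff k = 0 := by
  rw [coeff_sub, coeff_X_add_C_pow, coeff_X_pow]
  rcases h.lt_or_eq with h | h
  · simp [Nat.choose_eq_zero_of_lt h, h.ne']
  · simp [h]

/-- Finite differences of matrix polynomials are matrix polynomials of smaller degree. -/
theorem exists_matEval_difference (Q : Polynomial (Mat N)) (m : ℕ) (hQ : Q.natDegree ≤ m + 1)
    (r : ℂ) :
    ∃ D : Polynomial (Mat N), D.natDegree ≤ m ∧
      D.coeff m = (((m : ℂ) + 1) * r) • Q.coeff (m + 1) ∧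
      ∀ z, matEval D z = matEval Q (z + r) - matEval Q z := by
  refine ⟨∑ i ∈ Finset.range (m + 2), C (Q.coeff i) * ((X + C (r • 1)) ^ i - X ^ i), ?_, ?_, ?_⟩
  · rw [natDegree_le_iff_coeff_eq_zero]
    intro k hk
    rw [finsetSum_coeff]
    refine Finset.sum_eq_zero fun i hi => ?_
    rw [coeff_C_mul, coeff_X_add_C_pow_sub_X_pow, mul_zero]
    have := Finset.mem_range.1 hi
    omega
  · rw [finsetSum_coeff, Finset.sum_range_succ, Finset.sum_eq_zero, zero_add, coeff_C_mul,
      coeff_sub, coeff_X_add_C_pow, coeff_X_pow]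
    · have : Commute (Q.coeff (m + 1)) (algebraMap ℂ (Mat N) r * ((m : Mat N) + 1)) :=
        (Algebra.commute_algebraMap_right r _).mul_right
          ((Nat.cast_commute m _).symm.add_right (.one_right _))
      simpa [mul_comm, Algebra.smul_def] using this.eq
    · intro i hi
      rw [coeff_C_mul, coeff_X_add_C_pow_sub_X_pow, mul_zero]
      have := Finset.mem_range.1 hi
      omega
  · intro z
    have key : ∀ w, matEval Q w =
        ∑ i ∈ Finset.range (m + 2), Q.coeff i * (w • (1 : Mat N)) ^ i := fun w =>
      eval_eq_sum_range' (by omega) _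
    rw [matEval_sum, key, key, ← Finset.sum_sub_distrib]
    refine Finset.sum_congr rfl fun i _ => ?_
    rw [matEval_C_mul, ← mul_sub, matEval_sub, matEval_pow, matEval_add, matEval_pow, matEval_X,
      matEval_C, ← add_smul]

/-- Convergence of all the matrix moments of `W`, phrased for arbitrary matrix polynomials. -/
def HasMoments (W : ℕ → Mat N) : Prop :=
  ∀ P Q : Polynomial (Mat N), Summable fun x : ℕ => matEval P x * W x * (matEval Q x)ᴴ

theorem conjTranspose_innerN (W : ℕ → Mat N) (P Q : Polynomial (Mat N)) :
    (innerN W P Q)ᴴ = innerN (fun x => (W x)ᴴ) Q P := by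
  unfold innerN
  rw [Matrix.conjTranspose_tsum]
  simp [Matrix.mul_assoc]

theorem HasMoments.conjTranspose {W : ℕ → Mat N} (hW : HasMoments W) :
    HasMoments fun x => (W x)ᴴ := by
  intro P Q
  simpa [Matrix.mul_assoc] using (hW Q P).matrix_conjTranspose

theorem IsMOSN.conjTranspose {W : ℕ → Mat N} {P : ℕ → Polynomial (Mat N)} (hP : IsMOSN W P) :
    IsMOSN (fun x => (W x)ᴴ) P where
  monic := hP.monic
  deg := hP.deg
  orth m n h := by rw [← conjTranspose_innerN, hP.orth n m h.symm, conjTranspose_zero]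

theorem innerN_add_left {W : ℕ → Mat N} (hW : HasMoments W) (P Q R : Polynomial (Mat N)) :
    innerN W (P + Q) R = innerN W P R + innerN W Q R := by
  unfold innerN
  rw [← (hW P R).tsum_add (hW Q R)]
  simp [matEval_add, Matrix.add_mul]

theorem innerN_C_mul_left {W : ℕ → Mat N} (hW : HasMoments W) (M : Mat N)
    (P R : Polynomial (Mat N)) : innerN W (C M * P) R = M * innerN W P R := by
  unfold innerN
  rw [← (hW P R).tsum_mul_left]
  simp [matEval_C_mul, Matrix.mul_assoc]

theorem IsMOSN.coeff_self {W : ℕ → Mat N} {P : ℕ → Polynomial (Mat N)} (hP : IsMOSN W P) (m : ℕ) :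
    (P m).coeff m = 1 := by
  have := hP.monic m
  rwa [Monic, leadingCoeff, hP.deg] at this

theorem IsMOSN.coeff_sub_C_mul_eq_zero {W : ℕ → Mat N} {P : ℕ → Polynomial (Mat N)} (hP : IsMOSN W P)
    {m : ℕ} {R : Polynomial (Mat N)} (hR : ∀ k, m < k → R.coeff k = 0) (k : ℕ) (hk : m ≤ k) :
    (R - C (R.coeff m) * P m).coeff k = 0 := by
  rcases hk.eq_or_lt with rfl | hk
  · simp [hP.coeff_self]
  · rw [coeff_sub, coeff_C_mul, hR k hk,
      coeff_eq_zero_of_natDegree_lt (p := P m) (by rwa [hP.deg])]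
    simp

theorem IsMOSN.innerN_eq_zero {W : ℕ → Mat N} (hW : HasMoments W) {P : ℕ → Polynomial (Mat N)}
    (hP : IsMOSN W P) (m k : ℕ) (hk : k ≤ m) (R : Polynomial (Mat N))
    (hR : ∀ i, k ≤ i → R.coeff i = 0) : innerN W R (P m) = 0 := by
  induction k generalizing R with
  | zero =>
    have : R = 0 := by ext1 i; simpa using hR i (Nat.zero_le _)
    simp [this, innerN, matEval]
  | succ k ih =>
    have h := ih (by omega) (R - C (R.coeff k) * P k) (hP.coeff_sub_C_mul_eq_zero fun i hi => hR i hi)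
    rw [← sub_add_cancel R (C (R.coeff k) * P k), innerN_add_left hW, h, innerN_C_mul_left hW,
      hP.orth k m (by omega)]
    simp

theorem IsMOSN.innerN_left {W : ℕ → Mat N} (hW : HasMoments W) {P : ℕ → Polynomial (Mat N)}
    (hP : IsMOSN W P) (m : ℕ) (R : Polynomial (Mat N)) (hR : R.natDegree ≤ m) :
    innerN W R (P m) = R.coeff m * innerN W (P m) (P m) := by
  have h := hP.innerN_eq_zero hW m m le_rfl (R - C (R.coeff m) * P m)
    (hP.coeff_sub_C_mul_eq_zero fun i hi => coeff_eq_zero_of_natDegree_lt (by omega))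
  conv_lhs => rw [← sub_add_cancel R (C (R.coeff m) * P m)]
  rw [innerN_add_left hW, h, innerN_C_mul_left hW, zero_add]

theorem IsMOSN.innerN_right {W : ℕ → Mat N} (hW : HasMoments W) {P : ℕ → Polynomial (Mat N)}
    (hP : IsMOSN W P) (m : ℕ) (R : Polynomial (Mat N)) (hR : R.natDegree ≤ m) :
    innerN W (P m) R = innerN W (P m) (P m) * (R.coeff m)ᴴ := by
  have h := hP.conjTranspose.innerN_left hW.conjTranspose m R hR
  rw [← conjTranspose_innerN, ← conjTranspose_innerN] at h
  simpa using congrArg Matrix.conjTranspose h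

theorem pearson_ring_identity {R : Type*} [Ring R] (p e x k b c d : R) :
    p * (x * (b - c) - d) + e * x * (x * k + b) + p * (x * (x * k + c) + d) =
      (p + e) * (x * (x * k + b)) := by
  noncomm_ring

/-- Summation by parts along a matrix Pearson equation relating `W` and `W'`. -/
theorem innerN_mul_of_pearson {W W' : ℕ → Mat N} (hW : HasMoments W) (hW' : HasMoments W')
    {P P' : ℕ → Polynomial (Mat N)} (hP : IsMOSN W P) (hP' : IsMOSN W' P') {K B C₁ C₀ : Mat N}
    (h₁ : ∀ x : ℕ, W (x + 1) * (((x : ℂ) + 1) ^ 2 • K + ((x : ℂ) + 1) • B) = W' x)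
    (h₂ : ∀ x : ℕ, W x * ((x : ℂ) ^ 2 • K + (x : ℂ) • C₁ + C₀) = W' x) (n : ℕ) :
    innerN W (P (n + 1)) (P (n + 1)) * (B - C₁ - (n : ℂ) • K) =
      ((n : ℂ) + 1) • innerN W' (P' n) (P' n) := by
  obtain ⟨D, hD, hDc, hDe⟩ := exists_matEval_difference (P (n + 1)) n (hP.deg _).le 1
  have hr : innerN W' D (P' n) = ((n : ℂ) + 1) • innerN W' (P' n) (P' n) := by
    rw [hP'.innerN_left hW' n D hD, hDc, hP.coeff_self]
    simp
  obtain ⟨E, hE, hEe⟩ : ∃ E : Polynomial (Mat N),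
      (∀ k, n ≤ k → E.coeff k = 0 ∧ (E * X).coeff k = -(if k = n then (n : ℂ) else 0) • 1) ∧
      ∀ z, matEval E z = matEval (P' n) (z - 1) - matEval (P' n) z := by
    rcases n with _ | n
    · have : P' 0 = 1 := by
        have := hP'.coeff_self 0
        rw [eq_C_of_natDegree_le_zero (hP'.deg 0).le, this, map_one]
      exact ⟨0, by simp, by simp [this, matEval]⟩
    · obtain ⟨E, hE, hEc, hEe⟩ := exists_matEval_difference (P' (n + 1)) n (hP'.deg _).le (-1)
      refine ⟨E, fun k hk => ?_, fun z => by rw [hEe, sub_eq_add_neg z]⟩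
      obtain ⟨k, rfl⟩ : ∃ j, k = j + 1 := ⟨k - 1, by omega⟩
      refine ⟨coeff_eq_zero_of_natDegree_lt (by omega), ?_⟩
      rw [coeff_mul_X]
      split_ifs with h
      · have : k = n := by omega
        subst this
        rw [hEc, hP'.coeff_self]
        simp
      · rw [coeff_eq_zero_of_natDegree_lt (by omega)]
        simp
  set Q : Polynomial (Mat N) := P' n * (X * C (B - C₁)ᴴ - C C₀ᴴ)
    + E * X * (X * C Kᴴ + C Bᴴ) with hQ
  have hPn : ∀ k, n < k → (P' n).coeff k = 0 := fun k hk =>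
    coeff_eq_zero_of_natDegree_lt (by rwa [hP'.deg])
  have hQc : ∀ k, n ≤ k →
      Q.coeff (k + 1) = if k = n then (B - C₁ - (n : ℂ) • K)ᴴ else 0 := by
    intro k hk
    rw [hQ, mul_sub, mul_add, ← mul_assoc, ← mul_assoc, coeff_add, coeff_sub, coeff_add,
      coeff_mul_C, coeff_mul_C, coeff_mul_C, coeff_mul_C, coeff_mul_X, coeff_mul_X,
      hPn (k + 1) (by omega), (hE k hk).2, coeff_mul_X, (hE k hk).1]
    split_ifs with h
    · subst h
      simp [hP'.coeff_self, sub_eq_add_neg]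
    · simp [hPn k (by omega)]
  have hQd : Q.natDegree ≤ n + 1 := by
    rw [natDegree_le_iff_coeff_eq_zero]
    intro k hk
    obtain ⟨k, rfl⟩ : ∃ j, k = j + 1 := ⟨k - 1, by omega⟩
    rw [hQc k (by omega), if_neg (by omega)]
  have hl := hP.innerN_right hW (n + 1) Q hQd
  rw [hQc n le_rfl, if_pos rfl, conjTranspose_conjTranspose] at hl
  rw [← hr, ← hl]
  set Φ : Polynomial (Mat N) := X * (X * C Kᴴ + C Bᴴ) with hΦ
  set Ψ : Polynomial (Mat N) := X * (X * C Kᴴ + C C₁ᴴ) + C C₀ᴴ with hΨ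
  have hΦe : ∀ x : ℕ, (matEval Φ x)ᴴ = (x : ℂ) ^ 2 • K + (x : ℂ) • B := fun x => by
    simp [hΦ, matEval_mul, matEval_add, matEval_X, matEval_C, pow_two, smul_smul]
  have hΨe : ∀ x : ℕ, (matEval Ψ x)ᴴ = (x : ℂ) ^ 2 • K + (x : ℂ) • C₁ + C₀ := fun x => by
    simp [hΨ, matEval_mul, matEval_add, matEval_X, matEval_C, pow_two, smul_smul]
  have hQe : ∀ x : ℕ, W x * (matEval Q x)ᴴ =
      W x * (matEval Φ x)ᴴ * (matEval (P' n) ((x : ℂ) - 1))ᴴ - W' x * (matEval (P' n) x)ᴴ := by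
    intro x
    have : Q + P' n * Ψ = (P' n + E) * Φ := by
      rw [hQ, hΦ, hΨ, conjTranspose_sub, C_sub]
      exact pearson_ring_identity _ _ _ _ _ _ _
    have h := congrArg (fun R => matEval R (x : ℂ)) this
    simp only [matEval_add, matEval_mul, hEe] at h
    rw [← h₂ x, ← hΨe, Matrix.mul_assoc, Matrix.mul_assoc, ← Matrix.mul_sub,
      ← conjTranspose_mul, ← conjTranspose_mul, ← conjTranspose_sub, eq_sub_of_add_eq h]
    simp
  set f : ℕ → Mat N := fun x => matEval (P (n + 1)) x *
    (W x * (matEval Φ x)ᴴ * (matEval (P' n) ((x : ℂ) - 1))ᴴ) with hf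
  have hf0 : f 0 = 0 := by simp [hf, hΦe]
  have hf1 : ∀ x, f (x + 1) = matEval D x * W' x * (matEval (P' n) x)ᴴ +
      matEval (P (n + 1)) x * W' x * (matEval (P' n) x)ᴴ := by
    intro x
    have := h₁ x
    simp only [hf]
    rw [hΦe, hDe]
    push_cast
    rw [this, add_sub_cancel_right, sub_mul, sub_mul, sub_add_cancel, Matrix.mul_assoc]
  have hs1 := hW' D (P' n)
  have hs2 := hW' (P (n + 1)) (P' n)
  have hfs : Summable f := by
    rw [← summable_nat_add_iff 1]
    simpa only [hf1] using hs1.add hs2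
  have hft : ∑' x, f x = innerN W' D (P' n) + innerN W' (P (n + 1)) (P' n) := by
    rw [hfs.tsum_eq_zero_add, hf0, zero_add]
    simp only [hf1]
    exact hs1.tsum_add hs2
  calc innerN W (P (n + 1)) Q = ∑' x : ℕ, (f x - matEval (P (n + 1)) x * W' x *
        (matEval (P' n) x)ᴴ) := by
        unfold innerN
        refine tsum_congr fun x => ?_
        rw [Matrix.mul_assoc, hQe, Matrix.mul_sub]
        simp only [hf, Matrix.mul_assoc]
    _ = _ := by
        rw [hfs.tsum_sub hs2, hft]
        exact add_sub_cancel_right _ _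

end MatrixOrthogonalPolynomials

section BanachAlgebra

variable {B : Type*} [NormedRing B] [NormedAlgebra ℂ B]

/-- Left multiplication by `x` composed with right multiplication by `y`. -/
def mulLeftRight (x y : B) : B →L[ℂ] B :=
  ContinuousLinearMap.mul ℂ B x * (ContinuousLinearMap.mul ℂ B).flip y

theorem mulLeftRight_apply (x y t : B) : mulLeftRight x y t = x * t * y := by
  simp [mulLeftRight, mul_assoc]

theorem mulLeftRight_pow_apply (x y t : B) (n : ℕ) :
    (mulLeftRight x y ^ n) t = x ^ n * t * y ^ n := by
  induction n with
  | zero => simp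
  | succ n ih =>
    rw [pow_succ', mul_apply_eq_comp, ih, mulLeftRight_apply, pow_succ' x, pow_succ y]
    simp only [mul_assoc]

theorem commute_mulLeftRight {x y x' y' : B} (hx : Commute x x') (hy : Commute y' y) :
    Commute (mulLeftRight x y) (mulLeftRight x' y') := by
  ext t
  simp only [mul_apply_eq_comp, mulLeftRight_apply]
  rw [← mul_assoc, ← mul_assoc, hx.eq]
  simp only [mul_assoc, hy.eq]

theorem mulLeftRight_one_add (x y : B) :
    mulLeftRight (1 + x) (1 + y) =
      1 + (mulLeftRight x 1 + (mulLeftRight 1 y + mulLeftRight x y)) := by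
  ext t
  simp only [_root_.add_apply, mulLeftRight_apply, one_apply_eq_self]
  noncomm_ring

variable [CompleteSpace B]

theorem hasSum_exp_smul (a : ℂ) (x : B) :
    HasSum (fun n : ℕ => (a ^ n / n.factorial) • x ^ n) (NormedSpace.exp (a • x)) := by
  simpa only [_root_.smul_pow, smul_smul, div_eq_inv_mul] using
    NormedSpace.exp_series_hasSum_exp' (𝕂 := ℂ) (a • x)

theorem exp_smul_add_of_commute (a : ℂ) {x y : B} (h : Commute x y) :
    NormedSpace.exp (a • (x + y)) = NormedSpace.exp (a • x) * NormedSpace.exp (a • y) := by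
  let _ : NormedAlgebra ℚ B := NormedAlgebra.restrictScalars ℚ ℂ B
  rw [smul_add, NormedSpace.exp_add_of_commute ((h.smul_left a).smul_right a)]

theorem hasSum_exp_smul_apply (a : ℂ) (Φ : B →L[ℂ] B) (t : B) :
    HasSum (fun n : ℕ => (a ^ n / n.factorial) • (Φ ^ n) t) (NormedSpace.exp (a • Φ) t) :=
  (hasSum_exp_smul a Φ).mapL (ContinuousLinearMap.apply ℂ B t)

/-- Poisson-type sums of `(1 + x)^n t (1 + y)^n` factor through exponentials. -/
theorem hasSum_one_add_pow_mul_mul_one_add_pow (a : ℂ) {x y t d : B}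
    (hd : HasSum (fun n : ℕ => (a ^ n / n.factorial) • (x ^ n * t * y ^ n)) d) :
    HasSum (fun n : ℕ => (a ^ n / n.factorial) • ((1 + x) ^ n * t * (1 + y) ^ n))
      (Complex.exp a • (NormedSpace.exp (a • x) * d * NormedSpace.exp (a • y))) := by
  have h := hasSum_exp_smul_apply a (mulLeftRight (1 + x) (1 + y)) t
  simp only [mulLeftRight_pow_apply] at h
  have key : NormedSpace.exp (a • mulLeftRight (1 + x) (1 + y)) t =
      Complex.exp a • (NormedSpace.exp (a • x) * d * NormedSpace.exp (a • y)) := by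
    have c₁ : Commute (mulLeftRight 1 y) (mulLeftRight x y) :=
      commute_mulLeftRight (.one_left _) (.refl _)
    have c₂ : Commute (mulLeftRight x 1) (mulLeftRight 1 y + mulLeftRight x y) :=
      (commute_mulLeftRight (.one_right _) (.one_right _)).add_right
        (commute_mulLeftRight (.refl _) (.one_right _))
    rw [mulLeftRight_one_add, exp_smul_add_of_commute a (.one_left _),
      exp_smul_add_of_commute a c₂, exp_smul_add_of_commute a c₁]
    simp only [mul_apply_eq_comp]
    have h1 : NormedSpace.exp (a • mulLeftRight x y) t = d :=
      (hasSum_exp_smul_apply a (mulLeftRight x y) t).unique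
        (by simpa only [mulLeftRight_pow_apply] using hd)
    have h2 : ∀ s, NormedSpace.exp (a • mulLeftRight 1 y) s = s * NormedSpace.exp (a • y) := by
      intro s
      refine (hasSum_exp_smul_apply a (mulLeftRight 1 y) s).unique ?_
      simpa only [mulLeftRight_pow_apply, one_pow, one_mul, mul_one, mul_smul_comm,
        smul_mul_assoc] using (hasSum_exp_smul a y).mul_left s
    have h3 : ∀ s, NormedSpace.exp (a • mulLeftRight x 1) s = NormedSpace.exp (a • x) * s := by
      intro s
      refine (hasSum_exp_smul_apply a (mulLeftRight x 1) s).unique ?_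
      simpa only [mulLeftRight_pow_apply, one_pow, one_mul, mul_one, mul_smul_comm,
        smul_mul_assoc] using (hasSum_exp_smul a x).mul_right s
    have h4 : ∀ s : B, NormedSpace.exp (a • (1 : B →L[ℂ] B)) s = Complex.exp a • s := by
      intro s
      refine (hasSum_exp_smul_apply a 1 s).unique ?_
      simpa [Complex.exp_eq_exp_ℂ] using (hasSum_exp_smul a (1 : ℂ)).smul_const s
    rw [h1, h2, h3, h4, mul_assoc]
  rwa [key] at h

/-- If `[j, e] = -e` then `j exp(a e) = exp(a e) (j - a e)`. -/
theorem mul_exp_smul_of_commutator {j e : B} (h : j * e = e * j - e) (a : ℂ) :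
    j * NormedSpace.exp (a • e) = NormedSpace.exp (a • e) * (j - a • e) := by
  have hp : ∀ n : ℕ, j * e ^ n = e ^ n * j - (n : ℂ) • e ^ n := by
    intro n
    induction n with
    | zero => simp
    | succ n ih =>
      rw [pow_succ, ← mul_assoc, ih, sub_mul, mul_assoc, h, smul_mul_assoc, ← pow_succ]
      push_cast
      rw [mul_sub, ← mul_assoc, ← pow_succ, add_smul, one_smul]
      abel
  have h1 := (hasSum_exp_smul a e).mul_left j
  have h2 := (hasSum_exp_smul a e).mul_right j
  have h3 : HasSum (fun n : ℕ => (a ^ n / n.factorial) • ((n : ℂ) • e ^ n))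
      (NormedSpace.exp (a • e) * (a • e)) := by
    rw [← hasSum_nat_add_iff' 1]
    simp only [Finset.range_one, Finset.sum_singleton, Nat.cast_zero, zero_smul, smul_zero,
      sub_zero]
    have h := (hasSum_exp_smul a e).mul_right (a • e)
    refine (congrArg (HasSum · _) (funext fun n => ?_)).mp h
    rw [mul_smul_comm, smul_mul_assoc, ← pow_succ, smul_smul, smul_smul, Nat.factorial_succ]
    congr 1
    have := Nat.factorial_ne_zero n
    push_cast
    field_simp
    ring
  rw [mul_sub]
  refine h1.unique ?_
  have h4 := h2.sub h3
  simp only [smul_mul_assoc, ← smul_sub, ← hp] at h4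
  simpa only [mul_smul_comm] using h4

end BanachAlgebra

section Commutators

variable {R : Type*} [Ring R] [Algebra ℂ R]

theorem mul_one_add_pow_of_commutator {j e z : R} (h : j * e = e * j - e)
    (hz : (1 + e) * z = e) (hz' : z * (1 + e) = e) (y : ℕ) :
    j * (1 + e) ^ y = (1 + e) ^ y * (j - (y : ℂ) • z) := by
  induction y with
  | zero => simp
  | succ y ih =>
    have hj : j * (1 + e) = (1 + e) * (j - z) := by
      rw [mul_sub, hz, mul_add, h, add_mul]
      simp [add_sub_assoc]
    have he : (y : ℂ) • e = (1 + e) * ((y : ℂ) • z) := by rw [mul_smul_comm, hz]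
    rw [pow_succ, ← mul_assoc, ih, mul_assoc, sub_mul, hj, smul_mul_assoc, hz', he, ← mul_sub,
      mul_assoc]
    congr 2
    push_cast
    rw [add_smul, one_smul]
    abel

theorem mul_one_add_pow_succ_of_commutator {e f g z : R} {c : ℂ} (h : e * f = f * e + g)
    (hg : g * e = e * g + (2 * c) • e)
    (hz : (1 + e) * z = e) (hz' : z * (1 + e) = e) (y : ℕ) :
    f * (1 + e) ^ (y + 1) =
      (1 + e) ^ y * (f * (1 + e) - (y : ℂ) • g - ((y : ℂ) * (y + 1) * c) • z) := by
  induction y with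
  | zero => simp
  | succ y ih =>
    have hf : f * (1 + e) = (1 + e) * f - g := by
      rw [mul_add, add_mul, h]
      simp [add_sub_assoc]
    have hg' : g * (1 + e) = (1 + e) * (g + (2 * c) • z) := by
      rw [mul_add, mul_add, mul_smul_comm, hz, hg, add_mul, mul_one, one_mul, add_assoc]
    have hf' : f * (1 + e) * (1 + e) =
        (1 + e) * (f * (1 + e) - (g + (2 * c) • z)) := by
      conv_lhs => rw [hf]
      rw [sub_mul, hg', mul_assoc, ← mul_sub]
    have he : ((y : ℂ) * (y + 1) * c) • e = (1 + e) * (((y : ℂ) * (y + 1) * c) • z) := by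
      rw [mul_smul_comm, hz]
    rw [pow_succ, ← mul_assoc, ih, mul_assoc, sub_mul, sub_mul, hf', smul_mul_assoc, hg',
      smul_mul_assoc, hz', he, pow_succ, mul_assoc ((1 + e) ^ y) (1 + e), ← mul_smul_comm,
      ← mul_sub, ← mul_sub]
    congr 2
    push_cast
    module

end Commutators

section CharlierMatrices

variable {N : ℕ} {a : ℝ}

theorem μch_ne_zero (ha : 0 < a) (j : ℕ) : μch N a j ≠ 0 := by
  have := Real.sqrt_pos.2 ha
  have := Nat.factorial_pos (N - j)
  unfold μch
  positivity

theorem sq_μch (ha : 0 < a) (j : ℕ) : μch N a j ^ 2 = (a ^ j * (N - j).factorial)⁻¹ := by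
  unfold μch
  rw [inv_pow, mul_pow, Real.sq_sqrt (by positivity), ← pow_mul, mul_comm j 2, pow_mul,
    Real.sq_sqrt ha.le]

theorem Amat_pow_apply {μ : ℕ → ℝ} (hμ : ∀ j, μ j ≠ 0) (l : ℕ) (j k : Fin N) :
    (Amat N μ ^ l) j k =
      if (j : ℕ) = k + l then ((μ ((j : ℕ) + 1) / μ ((k : ℕ) + 1) : ℝ) : ℂ) else 0 := by
  induction l generalizing j k with
  | zero =>
    rw [pow_zero, Matrix.one_apply]
    by_cases h : j = k
    · subst h
      simp [hμ]
    · simp [h, Fin.val_inj]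
  | succ l ih =>
    rw [pow_succ, Matrix.mul_apply]
    simp only [ih]
    by_cases hk : (k : ℕ) + 1 < N
    · rw [Finset.sum_eq_single (⟨k + 1, hk⟩ : Fin N)]
      · by_cases h : (j : ℕ) = k + (l + 1)
        · have h' : (j : ℕ) = k + 1 + l := by omega
          have h1 := hμ (k + 1)
          have h2 := hμ (k + 1 + 1)
          rw [if_pos h', if_pos h]
          simp only [Amat, Matrix.of_apply, if_true]
          rw [← Complex.ofReal_mul]
          congr 1
          field_simp
        · have h' : ¬ (j : ℕ) = k + 1 + l := by omega
          simp [h, h']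
      · intro i _ hi
        have : ¬ (i : ℕ) = k + 1 := fun h => hi (Fin.ext h)
        simp [Amat, this]
      · simp
    · have h : ¬ (j : ℕ) = k + (l + 1) := by omega
      rw [if_neg h]
      refine Finset.sum_eq_zero fun i _ => ?_
      have : ¬ (i : ℕ) = k + 1 := by omega
      simp [Amat, this]

theorem μch_ratio_sq (ha : 0 < a) {k : ℕ} (hk : k + 1 < N) :
    (μch N a (k + 1 + 1) / μch N a (k + 1)) ^ 2 = ((N : ℝ) - (k + 1)) / a := by
  rw [div_pow, sq_μch ha, sq_μch ha]
  obtain ⟨m, rfl⟩ : ∃ m, N = k + 1 + 1 + m := ⟨N - (k + 1 + 1), by omega⟩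
  have h1 : k + 1 + 1 + m - (k + 1 + 1) = m := by omega
  have h2 : k + 1 + 1 + m - (k + 1) = m + 1 := by omega
  rw [h1, h2, Nat.factorial_succ]
  have := Nat.factorial_pos m
  push_cast
  field_simp
  ring

theorem conjTranspose_Amat_mul_Amat (ha : 0 < a) :
    (Amat N (μch N a))ᴴ * Amat N (μch N a) =
      Matrix.diagonal fun k : Fin N => ((N : ℂ) - ((k : ℂ) + 1)) / a := by
  ext i k
  rw [Matrix.mul_apply, Matrix.diagonal_apply]
  by_cases hk : (k : ℕ) + 1 < N
  · rw [Finset.sum_eq_single (⟨k + 1, hk⟩ : Fin N)]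
    · rw [Matrix.conjTranspose_apply]
      by_cases h : i = k
      · subst h
        simp only [Amat, Matrix.of_apply, if_true]
        rw [Complex.star_def, Complex.conj_ofReal, ← pow_two, ← Complex.ofReal_pow,
          μch_ratio_sq ha hk]
        simp
      · have : ¬ (k : ℕ) = i := fun h' => h (Fin.ext h'.symm)
        simp [Amat, h, this]
    · intro j _ hj
      have : ¬ (j : ℕ) = k + 1 := fun h => hj (Fin.ext h)
      simp [Amat, this]
    · simp
  · rw [Finset.sum_eq_zero]
    · have hN : (N : ℂ) = (k : ℂ) + 1 := by
        have : N = (k : ℕ) + 1 := by omega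
        exact_mod_cast this
      split_ifs with h
      · rw [h, hN]
        simp
      · rfl
    · intro j _
      have : ¬ (j : ℕ) = k + 1 := by omega
      simp [Amat, this]

theorem Amat_mul_conjTranspose_Amat_mul (ha : 0 < a) :
    Amat N (μch N a) * (Amat N (μch N a))ᴴ * Matrix.diagonal (fun k : Fin N => (k : ℂ)) =
      Matrix.diagonal fun k : Fin N => ((N : ℂ) - k) * k / a := by
  ext i k
  rw [Matrix.mul_diagonal, Matrix.mul_apply, Matrix.diagonal_apply]
  obtain ⟨k, hk⟩ := k
  rcases k with _ | k
  · have : i = ⟨0, hk⟩ → (0 : ℂ) = (N - i) * i / a := by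
      rintro rfl
      simp
    simpa using this
  · rw [Finset.sum_eq_single (⟨k, by omega⟩ : Fin N)]
    · rw [Matrix.conjTranspose_apply]
      by_cases h : i = ⟨k + 1, hk⟩
      · subst h
        simp only [Amat, Matrix.of_apply, if_true]
        rw [Complex.star_def, Complex.conj_ofReal, ← pow_two, ← Complex.ofReal_pow,
          μch_ratio_sq ha hk]
        simp
        ring
      · have : ¬ (i : ℕ) = k + 1 := fun h' => h (Fin.ext h')
        simp [Amat, h, this]
    · intro j _ hj
      have : ¬ k = (j : ℕ) := fun h => hj (Fin.ext h.symm)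
      simp [Amat, this]
    · simp

theorem Jdiag_mul_conjTranspose_Amat (μ : ℕ → ℝ) :
    Jdiag N * (Amat N μ)ᴴ = (Amat N μ)ᴴ * Jdiag N - (Amat N μ)ᴴ := by
  ext i k
  simp only [Jdiag, Matrix.sub_apply, Matrix.diagonal_mul, Matrix.mul_diagonal,
    Matrix.conjTranspose_apply, Amat, Matrix.of_apply]
  split_ifs with h
  · rw [h]
    push_cast
    ring
  · simp

/-- The `sl₂`-type commutation relation behind the specific parameters. -/
theorem conjTranspose_Amat_mul_Amat_mul_Jdiag (ha : 0 < a) :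
    (Amat N (μch N a))ᴴ * (Amat N (μch N a) * Jdiag N) =
      Amat N (μch N a) * Jdiag N * (Amat N (μch N a))ᴴ +
        ((a : ℂ)⁻¹ • (((N : ℂ) + 1) • 1 - (2 : ℂ) • Jdiag N)) := by
  have hJ : Jdiag N = Matrix.diagonal (fun k : Fin N => (k : ℂ)) + 1 := by
    rw [← Matrix.diagonal_one, Matrix.diagonal_add]
    rfl
  have h : Amat N (μch N a) * Jdiag N * (Amat N (μch N a))ᴴ =
      Amat N (μch N a) * (Amat N (μch N a))ᴴ * Matrix.diagonal (fun k : Fin N => (k : ℂ)) := by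
    rw [Matrix.mul_assoc, Jdiag_mul_conjTranspose_Amat, hJ, Matrix.mul_add, Matrix.mul_one,
      add_sub_cancel_right, ← Matrix.mul_assoc]
  rw [h, Amat_mul_conjTranspose_Amat_mul ha, ← Matrix.mul_assoc, conjTranspose_Amat_mul_Amat ha]
  ext i k
  by_cases hik : i = k
  · subst hik
    simp [Jdiag]
    field_simp
    ring
  · simp [Jdiag, hik]

theorem isUnit_one_add_Amat (μ : ℕ → ℝ) : IsUnit (1 + Amat N μ) := by
  rw [Matrix.isUnit_iff_isUnit_det, Matrix.det_of_isLowerTriangular]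
  · simp [Amat]
  · intro i j hij
    have h : i < j := hij
    have h' : ¬ (i : ℕ) = j + 1 := by have : (i : ℕ) < j := h; omega
    simp [Amat, h.ne, h']

theorem δch_succ (a : ℝ) (lam k : ℕ) :
    δch a (lam + 1) (k + 1) = a / 2 * (lam + (k + 1)) * δch a lam (k + 1) := by
  have h1 : lam + 1 + (k + 1) - 1 = lam + k + 1 := by omega
  have h2 : lam + (k + 1) - 1 = lam + k := by omega
  unfold δch
  rw [h1, h2, Nat.factorial_succ]
  push_cast
  ring

theorem δch_succ_eq (a : ℝ) (lam k : ℕ) :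
    δch a (lam + 1) (k + 1) = a / 2 * (k + 1) * δch a lam (k + 1 + 1) := by
  have h1 : lam + 1 + (k + 1) - 1 = lam + k + 1 := by omega
  have h2 : lam + (k + 1 + 1) - 1 = lam + k + 1 := by omega
  have h3 : k + 1 + 1 - 1 = k + 1 := by omega
  unfold δch
  rw [h1, h2, h3, Nat.add_sub_cancel, Nat.factorial_succ k]
  have := Nat.factorial_pos k
  push_cast
  field_simp
  ring

theorem Tmat_succ (a : ℝ) (lam : ℕ) :
    Tmat N (δch a (lam + 1)) =
      Tmat N (δch a lam) * ((a / 2 : ℂ) • ((lam : ℂ) • 1 + Jdiag N)) := by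
  ext i k
  simp only [Tmat, Matrix.diagonal_mul]
  by_cases h : i = k
  · subst h
    simp [Jdiag, δch_succ]
    ring
  · simp [Jdiag, h]

theorem Amat_mul_Tmat_succ (a : ℝ) (lam : ℕ) (μ : ℕ → ℝ) :
    Amat N μ * Tmat N (δch a (lam + 1)) =
      Tmat N (δch a lam) * ((a / 2 : ℂ) • (Amat N μ * Jdiag N)) := by
  ext i k
  simp only [Tmat, Matrix.diagonal_mul, Matrix.mul_diagonal, Matrix.smul_apply, Jdiag, Amat,
    Matrix.of_apply]
  split_ifs with h
  · rw [δch_succ_eq, h]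
    push_cast
    simp
    ring
  · simp

end CharlierMatrices

section CharlierWeight

variable {N : ℕ} {a : ℝ}

section OperatorNorm

open scoped Matrix.Norms.Operator

theorem exists_norm_sum_pow_smul_le (n : ℕ) (c : ℕ → Mat N) :
    ∃ C : ℝ, 0 ≤ C ∧
      ∀ x : ℕ, ‖∑ i ∈ Finset.range n, (x : ℂ) ^ i • c i‖ ≤ C * Real.exp 1 ^ x := by
  refine ⟨∑ i ∈ Finset.range n, i.factorial * ‖c i‖,
    Finset.sum_nonneg fun i _ => by positivity, fun x => ?_⟩
  rw [Finset.sum_mul]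
  refine (norm_sum_le _ _).trans (Finset.sum_le_sum fun i _ => ?_)
  have h := Real.pow_div_factorial_le_exp (x : ℝ) (Nat.cast_nonneg x) i
  rw [div_le_iff₀ (by positivity)] at h
  rw [norm_smul, norm_pow, Complex.norm_natCast, ← Real.exp_nat_mul, mul_one]
  calc (x : ℝ) ^ i * ‖c i‖ ≤ (Real.exp x * i.factorial) * ‖c i‖ := by gcongr
    _ = _ := by ring

theorem matEval_eq_sum_pow_smul (P : Polynomial (Mat N)) (z : ℂ) :
    matEval P z = ∑ i ∈ Finset.range (P.natDegree + 1), z ^ i • P.coeff i := by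
  unfold matEval
  rw [eval_eq_sum_range]
  simp [_root_.smul_pow]

theorem norm_pow_le_const_mul (U : Mat N) (n : ℕ) : ‖U ^ n‖ ≤ (‖(1 : Mat N)‖ + 1) * ‖U‖ ^ n := by
  rcases n.eq_zero_or_pos with rfl | hn
  · simp
  · refine (norm_pow_le' U hn).trans (le_mul_of_one_le_left (by positivity) ?_)
    linarith [norm_nonneg (1 : Mat N)]

theorem hasMoments_Wch (μ δ : ℕ → ℝ) (ha : 0 < a) (lam : ℕ) : HasMoments (Wch N a μ δ lam) := by
  intro P Q
  obtain ⟨CP, hCP0, hCP⟩ := exists_norm_sum_pow_smul_le (P.natDegree + 1) P.coeff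
  obtain ⟨CQ, hCQ0, hCQ⟩ := exists_norm_sum_pow_smul_le (Q.natDegree + 1) fun i => (Q.coeff i)ᴴ
  set U := 1 + Amat N μ
  set V := 1 + (Amat N μ)ᴴ
  set c := ‖(1 : Mat N)‖ + 1
  have hc : 0 ≤ c := by positivity
  refine Summable.of_norm_bounded (g := fun x : ℕ =>
    (CP * CQ * (c * ‖U‖ ^ lam) * ‖Tmat N δ‖ * (c * ‖V‖ ^ lam)) *
      ((Real.exp 1 * Real.exp 1 * a * ‖U‖ * ‖V‖) ^ x / x.factorial))
    ((Real.summable_pow_div_factorial _).mul_left _) fun x => ?_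
  have hQ : (matEval Q x)ᴴ =
      ∑ i ∈ Finset.range (Q.natDegree + 1), (x : ℂ) ^ i • (Q.coeff i)ᴴ := by
    rw [matEval_eq_sum_pow_smul, Matrix.conjTranspose_sum]
    simp
  have hP := hCP x
  have hQ' := hCQ x
  rw [← matEval_eq_sum_pow_smul] at hP
  rw [← hQ] at hQ'
  have hw : ‖((a ^ x / x.factorial : ℝ) : ℂ)‖ = a ^ x / x.factorial := by
    rw [Complex.norm_real, Real.norm_of_nonneg (by positivity)]
  calc ‖matEval P x * Wch N a μ δ lam x * (matEval Q x)ᴴ‖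
      ≤ ‖matEval P x‖ * ((a ^ x / x.factorial) * (‖U ^ (x + lam)‖ * ‖Tmat N δ‖ *
          ‖V ^ (x + lam)‖)) * ‖(matEval Q x)ᴴ‖ := by
        refine (norm_mul_le _ _).trans (mul_le_mul_of_nonneg_right ?_ (norm_nonneg _))
        refine (norm_mul_le _ _).trans (mul_le_mul_of_nonneg_left ?_ (norm_nonneg _))
        rw [Wch, norm_smul, hw]
        gcongr
        refine (norm_mul_le _ _).trans (mul_le_mul_of_nonneg_right ?_ (norm_nonneg _))
        exact norm_mul_le _ _
    _ ≤ (CP * Real.exp 1 ^ x) * ((a ^ x / x.factorial) * ((c * ‖U‖ ^ (x + lam)) * ‖Tmat N δ‖ *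
          (c * ‖V‖ ^ (x + lam)))) * (CQ * Real.exp 1 ^ x) := by
        have hU := norm_pow_le_const_mul U (x + lam)
        have hV := norm_pow_le_const_mul V (x + lam)
        gcongr
    _ = _ := by
        rw [pow_add, pow_add, mul_pow, mul_pow, mul_pow, mul_pow]
        ring

end OperatorNorm

open scoped Matrix.Norms.Operator in
theorem Matrix.hasSum_exp_smul (t : ℂ) (X : Mat N) :
    HasSum (fun n : ℕ => (t ^ n / n.factorial) • X ^ n) (NormedSpace.exp (t • X)) :=
  _root_.hasSum_exp_smul t X

open scoped Matrix.Norms.Operator in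
theorem Matrix.hasSum_one_add_pow_mul_mul_one_add_pow (t : ℂ) {X Y T D : Mat N}
    (hD : HasSum (fun n : ℕ => (t ^ n / n.factorial) • (X ^ n * T * Y ^ n)) D) :
    HasSum (fun n : ℕ => (t ^ n / n.factorial) • ((1 + X) ^ n * T * (1 + Y) ^ n))
      (Complex.exp t • (NormedSpace.exp (t • X) * D * NormedSpace.exp (t • Y))) :=
  _root_.hasSum_one_add_pow_mul_mul_one_add_pow t hD

open scoped Matrix.Norms.Operator in
theorem Matrix.mul_exp_smul_of_commutator {J E : Mat N} (h : J * E = E * J - E) (t : ℂ) :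
    J * NormedSpace.exp (t • E) = NormedSpace.exp (t • E) * (J - t • E) :=
  _root_.mul_exp_smul_of_commutator h t

theorem charlier_zero_right (t : ℂ) (n : ℕ) : charlier t n 0 = 1 := by
  unfold charlier
  rw [Finset.sum_range_succ', Finset.sum_eq_zero]
  · simp
  · intro k _
    simp

theorem Lmat_zero {μ : ℕ → ℝ} (hμ : ∀ j, μ j ≠ 0) :
    Lmat N a μ 0 = NormedSpace.exp ((-a : ℂ) • Amat N μ) := by
  ext j k
  have h := Pi.hasSum.1 (Pi.hasSum.1 (Matrix.hasSum_exp_smul (-a : ℂ) (Amat N μ)) j) k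
  refine HasSum.unique ?_ h
  have h0 : ∀ l : ℕ, (((-a : ℂ) ^ l / l.factorial) • Amat N μ ^ l) j k =
      ((-a : ℂ) ^ l / l.factorial) *
        if (j : ℕ) = k + l then ((μ ((j : ℕ) + 1) / μ ((k : ℕ) + 1) : ℝ) : ℂ) else 0 := fun l => by
    rw [Matrix.smul_apply, Amat_pow_apply hμ, smul_eq_mul]
  simp only [h0]
  rw [Lmat, Matrix.of_apply, charlier_zero_right]
  split_ifs with hkj
  · convert hasSum_single ((j : ℕ) - k) ?_ using 1
    · rw [if_pos (by omega)]
      ring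
    · intro l hl
      rw [if_neg (by omega), mul_zero]
  · convert hasSum_zero with l
    rw [if_neg (by omega), mul_zero]

theorem inv_Lmat_zero {μ : ℕ → ℝ} (hμ : ∀ j, μ j ≠ 0) :
    (Lmat N a μ 0)⁻¹ = NormedSpace.exp ((a : ℂ) • Amat N μ) := by
  rw [Lmat_zero hμ, ← Matrix.exp_neg, neg_smul, neg_neg]

theorem inv_conjTranspose_Lmat_zero {μ : ℕ → ℝ} (hμ : ∀ j, μ j ≠ 0) :
    ((Lmat N a μ 0)ᴴ)⁻¹ = NormedSpace.exp ((a : ℂ) • (Amat N μ)ᴴ) := by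
  rw [← Matrix.conjTranspose_nonsing_inv, inv_Lmat_zero hμ, ← Matrix.exp_conjTranspose,
    Matrix.conjTranspose_smul]
  simp

end CharlierWeight

section CharlierNorms

variable {N : ℕ} {a : ℝ}

theorem Wch_succ_mul (μ : ℕ → ℝ) (lam : ℕ) {Z : Mat N} (hZ : (1 + (Amat N μ)ᴴ) * Z = (Amat N μ)ᴴ)
    (hZ' : Z * (1 + (Amat N μ)ᴴ) = (Amat N μ)ᴴ) (x : ℕ) :
    Wch N a μ (δch a lam) lam (x + 1) * (((x : ℂ) + 1) ^ 2 • ((-(1 / 2) : ℂ) • Z) +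
        ((x : ℂ) + 1) • ((1 / 2 : ℂ) • ((lam : ℂ) • 1 + Jdiag N - (lam : ℂ) • Z))) =
      Wch N a μ (δch a (lam + 1)) (lam + 1) x := by
  have h := mul_one_add_pow_of_commutator (Jdiag_mul_conjTranspose_Amat μ) hZ hZ' (x + (lam + 1))
  have h1 : ((x : ℂ) + 1) ^ 2 • ((-(1 / 2) : ℂ) • Z) +
        ((x : ℂ) + 1) • ((1 / 2 : ℂ) • ((lam : ℂ) • 1 + Jdiag N - (lam : ℂ) • Z)) =
      (((x : ℂ) + 1) / 2) • ((lam : ℂ) • 1 + (Jdiag N - ((x + (lam + 1) : ℕ) : ℂ) • Z)) := by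
    push_cast
    module
  have hx : x + 1 + lam = x + (lam + 1) := by omega
  have hw : ((a ^ (x + 1) / (x + 1).factorial : ℝ) : ℂ) * (((x : ℂ) + 1) / 2) =
      ((a ^ x / x.factorial : ℝ) : ℂ) * (a / 2) := by
    rw [Nat.factorial_succ]
    have h1 : (x.factorial : ℂ) ≠ 0 := by exact_mod_cast x.factorial_ne_zero
    have h2 : (x : ℂ) + 1 ≠ 0 := by exact_mod_cast x.succ_ne_zero
    push_cast
    field_simp
    ring
  have h2 : (1 + (Amat N μ)ᴴ) ^ (x + (lam + 1)) *
        ((lam : ℂ) • 1 + (Jdiag N - ((x + (lam + 1) : ℕ) : ℂ) • Z)) =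
      ((lam : ℂ) • 1 + Jdiag N) * (1 + (Amat N μ)ᴴ) ^ (x + (lam + 1)) := by
    rw [mul_add, ← h, add_mul]
    simp
  rw [h1, Wch, Wch, hx, smul_mul_smul_comm, hw, Tmat_succ, mul_assoc, h2]
  simp only [mul_smul_comm, smul_mul_assoc, smul_smul, mul_assoc]

theorem Wch_mul (ha : 0 < a) (lam : ℕ) {Z : Mat N}
    (hZ : (1 + (Amat N (μch N a))ᴴ) * Z = (Amat N (μch N a))ᴴ)
    (hZ' : Z * (1 + (Amat N (μch N a))ᴴ) = (Amat N (μch N a))ᴴ)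
    {h E : Mat N} (hE : E = (Amat N (μch N a))ᴴ)
    (hh : h = (a : ℂ)⁻¹ • (((N : ℂ) + 1) • 1 - (2 : ℂ) • Jdiag N)) (x : ℕ) :
    Wch N a (μch N a) (δch a lam) lam x * ((x : ℂ) ^ 2 • ((-(1 / 2) : ℂ) • Z) +
        (x : ℂ) • ((a / 2 : ℂ) • (-E - h - ((2 * lam + 1) / a : ℂ) • Z)) +
        (a / 2 : ℂ) • (((lam : ℂ) • 1 + Jdiag N + Amat N (μch N a) * Jdiag N) * (1 + E) -
          (lam : ℂ) • E - (lam : ℂ) • h - (lam * (lam + 1) / a : ℂ) • Z)) =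
      Wch N a (μch N a) (δch a (lam + 1)) (lam + 1) x := by
  have ha' : (a : ℂ) ≠ 0 := by exact_mod_cast ha.ne'
  have hJ := Jdiag_mul_conjTranspose_Amat (N := N) (μch N a)
  have hF := conjTranspose_Amat_mul_Amat_mul_Jdiag (N := N) ha
  rw [← hE] at hZ hZ' hJ hF
  rw [← hh] at hF
  have hg : h * E = E * h + (2 * (a : ℂ)⁻¹) • E := by
    rw [hh, smul_mul_assoc, sub_mul, smul_mul_assoc, smul_mul_assoc, hJ, mul_smul_comm, mul_sub,
      mul_smul_comm, mul_smul_comm, one_mul, mul_one]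
    module
  set A := Amat N (μch N a)
  set J := Jdiag N
  have h2 := mul_one_add_pow_succ_of_commutator hF hg hZ hZ' (x + lam)
  have h3 : (x : ℂ) ^ 2 • ((-(1 / 2) : ℂ) • Z) +
        (x : ℂ) • ((a / 2 : ℂ) • (-E - h - ((2 * lam + 1) / a : ℂ) • Z)) +
        (a / 2 : ℂ) • (((lam : ℂ) • 1 + J + A * J) * (1 + E) -
          (lam : ℂ) • E - (lam : ℂ) • h - (lam * (lam + 1) / a : ℂ) • Z) =
      (a / 2 : ℂ) • ((lam : ℂ) • (1 + E) + (J * (1 + E) - ((x + lam : ℕ) : ℂ) • E) +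
        (A * J * (1 + E) - ((x + lam : ℕ) : ℂ) • h -
          (((x + lam : ℕ) : ℂ) * ((x + lam : ℕ) + 1) * (a : ℂ)⁻¹) • Z)) := by
    rw [add_mul, add_mul, smul_mul_assoc, one_mul]
    push_cast
    match_scalars <;> field_simp <;> ring
  have h4 : (1 + E) ^ (x + lam) * (J * (1 + E) - ((x + lam : ℕ) : ℂ) • E) =
      J * (1 + E) ^ (x + lam + 1) := by
    rw [mul_sub, ← mul_assoc, mul_smul_comm, pow_succ, ← mul_assoc,
      mul_one_add_pow_of_commutator hJ hZ hZ' (x + lam), mul_assoc, mul_assoc, sub_mul,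
      smul_mul_assoc, hZ', mul_sub, mul_smul_comm]
  have hU : (1 + A) * Tmat N (δch a (lam + 1)) =
      Tmat N (δch a lam) * ((a / 2 : ℂ) • ((lam : ℂ) • 1 + J + A * J)) := by
    rw [add_mul, one_mul, Amat_mul_Tmat_succ, Tmat_succ, ← mul_add, ← smul_add]
  have h5 : (1 + E) ^ (x + lam) * ((lam : ℂ) • (1 + E) + (J * (1 + E) - ((x + lam : ℕ) : ℂ) • E) +
        (A * J * (1 + E) - ((x + lam : ℕ) : ℂ) • h -
          (((x + lam : ℕ) : ℂ) * ((x + lam : ℕ) + 1) * (a : ℂ)⁻¹) • Z)) =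
      ((lam : ℂ) • 1 + J + A * J) * (1 + E) ^ (x + lam + 1) := by
    rw [mul_add, mul_add, h4, ← h2, mul_smul_comm, ← pow_succ, add_mul, add_mul, smul_mul_assoc,
      one_mul]
  rw [h3, Wch, Wch, ← hE, ← add_assoc, pow_succ (1 + A), smul_mul_assoc, mul_assoc _ (1 + A), hU,
    mul_smul_comm, mul_assoc _ ((1 + E) ^ (x + lam)), h5]
  simp only [mul_smul_comm, smul_mul_assoc, mul_assoc]
  rfl

theorem innerN_Wch_succ_mul (ha : 0 < a) (lam : ℕ) {Z : Mat N}
    (hZ : (1 + (Amat N (μch N a))ᴴ) * Z = (Amat N (μch N a))ᴴ)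
    (hZ' : Z * (1 + (Amat N (μch N a))ᴴ) = (Amat N (μch N a))ᴴ)
    {P P' : ℕ → Polynomial (Mat N)} (hP : IsMOSN (Wch N a (μch N a) (δch a lam) lam) P)
    (hP' : IsMOSN (Wch N a (μch N a) (δch a (lam + 1)) (lam + 1)) P') (n : ℕ) :
    innerN (Wch N a (μch N a) (δch a lam) lam) (P (n + 1)) (P (n + 1)) *
        ((1 / 2 : ℂ) • (((lam : ℂ) + N + 1) • 1 - (Jdiag N - (a : ℂ) • (Amat N (μch N a))ᴴ -
          ((n + 1 + lam : ℕ) : ℂ) • Z))) =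
      ((n : ℂ) + 1) •
        innerN (Wch N a (μch N a) (δch a (lam + 1)) (lam + 1)) (P' n) (P' n) := by
  have ha' : (a : ℂ) ≠ 0 := by exact_mod_cast ha.ne'
  rw [← innerN_mul_of_pearson (hasMoments_Wch _ _ ha _) (hasMoments_Wch _ _ ha _) hP hP'
    (Wch_succ_mul _ lam hZ hZ') (Wch_mul ha lam hZ hZ' rfl rfl) n]
  congr 1
  push_cast
  match_scalars <;> field_simp <;> ring

open scoped Matrix.Norms.Operator in
theorem Jdiag_mul_one_add_pow_mul_exp (μ : ℕ → ℝ) {Z : Mat N}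
    (hZ : (1 + (Amat N μ)ᴴ) * Z = (Amat N μ)ᴴ)
    (hZ' : Z * (1 + (Amat N μ)ᴴ) = (Amat N μ)ᴴ) (t : ℂ) (q : ℕ) :
    Jdiag N * ((1 + (Amat N μ)ᴴ) ^ q * NormedSpace.exp (t • (Amat N μ)ᴴ)) =
      (1 + (Amat N μ)ᴴ) ^ q * NormedSpace.exp (t • (Amat N μ)ᴴ) *
        (Jdiag N - t • (Amat N μ)ᴴ - (q : ℂ) • Z) := by
  have hJ := Jdiag_mul_conjTranspose_Amat (N := N) μ
  have hc : Commute Z (NormedSpace.exp (t • (Amat N μ)ᴴ)) := by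
    refine Commute.exp_right (Commute.smul_right ?_ t)
    have h : Commute Z (1 + (Amat N μ)ᴴ) := hZ'.trans hZ.symm
    simpa using h.sub_right (Commute.one_right Z)
  rw [← mul_assoc, mul_one_add_pow_of_commutator hJ hZ hZ', mul_assoc, mul_assoc, sub_mul,
    Matrix.mul_exp_smul_of_commutator hJ, smul_mul_assoc, hc.eq, mul_sub _ _ ((q : ℂ) • Z),
    mul_smul_comm]

theorem Dch_succ_mul (n lam : ℕ) :
    Dch N a (n + 1) lam * ((1 / 2 : ℂ) • (((lam : ℂ) + N + 1) • 1 - Jdiag N)) =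
      ((n : ℂ) + 1) • Dch N a n (lam + 1) := by
  ext i k
  simp only [Dch, Matrix.diagonal_mul]
  by_cases h : i = k
  · subst h
    obtain ⟨m, hm⟩ : ∃ m, N = (i : ℕ) + 1 + m := ⟨N - (i + 1), by omega⟩
    have h1 : N - ((i : ℕ) + 1) = m := by omega
    have h2 : (N : ℂ) + ((lam + 1 : ℕ) : ℂ) + n = N + lam + ((n + 1 : ℕ) : ℂ) := by
      push_cast
      ring
    have h3 : ((lam + 1 : ℕ) : ℂ) + n + 1 = lam + ((n + 1 : ℕ) : ℂ) + 1 := by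
      push_cast
      ring
    have h4 : lam + 1 + m = lam + m + 1 := by omega
    have h5 : ((lam : ℂ) + N + 1) - (i + 1) = lam + m + 1 := by
      have : (N : ℂ) = (i : ℂ) + 1 + m := by exact_mod_cast hm
      rw [this]
      ring
    simp only [Matrix.smul_apply, Matrix.sub_apply, Matrix.one_apply_eq, Jdiag,
      Matrix.diagonal_apply_eq, smul_eq_mul, mul_one]
    rw [h1, h2, h3, h4, h5, Nat.factorial_succ (lam + m), Nat.factorial_succ n]
    push_cast
    ring
  · simp [Jdiag, h]

theorem sum_choose_mul_choose (p q m : ℕ) :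
    ∑ l ∈ Finset.range (m + 1), (p + l).choose p * (q + (m - l)).choose q =
      (p + q + 1 + m).choose (p + q + 1) := by
  have h : (PowerSeries.mk fun n => ((p + n).choose p : ℤ)) *
      (PowerSeries.mk fun n => ((q + n).choose q : ℤ)) =
      PowerSeries.mk fun n => ((p + q + 1 + n).choose (p + q + 1) : ℤ) := by
    rw [← PowerSeries.invOneSubPow_val_succ_eq_mk_add_choose,
      ← PowerSeries.invOneSubPow_val_succ_eq_mk_add_choose,
      ← PowerSeries.invOneSubPow_val_succ_eq_mk_add_choose, ← Units.val_mul,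
      ← PowerSeries.invOneSubPow_add]
    congr 2
    ring
  have h' := congrArg (PowerSeries.coeff m) h
  rw [PowerSeries.coeff_mul, Finset.Nat.sum_antidiagonal_eq_sum_range_succ_mk] at h'
  simp only [PowerSeries.coeff_mk] at h'
  exact_mod_cast h'

theorem smul_Amat_pow_mul_Tmat_mul_apply (ha : 0 < a) (lam l : ℕ) (i k : Fin N) :
    (((a : ℂ) ^ l / l.factorial) • (Amat N (μch N a) ^ l * Tmat N (δch a lam) *
        (Amat N (μch N a))ᴴ ^ l)) i k =
      if i = k ∧ l ≤ (k : ℕ) then ((a : ℂ) / 2) ^ lam * lam.factorial *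
        ((N - (k + 1) + l).choose (N - (k + 1)) * (lam + (k - l)).choose lam : ℕ) else 0 := by
  have ha' : (a : ℂ) ≠ 0 := by exact_mod_cast ha.ne'
  have hμ := μch_ne_zero (N := N) ha
  rw [Matrix.smul_apply, ← Matrix.conjTranspose_pow, Matrix.mul_apply]
  simp only [Tmat, Matrix.mul_diagonal, Matrix.conjTranspose_apply, Amat_pow_apply hμ]
  split_ifs with h
  · obtain ⟨rfl, hl⟩ := h
    rw [Finset.sum_eq_single (⟨i - l, by omega⟩ : Fin N)]
    · obtain ⟨m, hm⟩ : ∃ m, N = (i : ℕ) + 1 + m := ⟨N - (i + 1), by omega⟩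
      obtain ⟨r, hr⟩ : ∃ r, (i : ℕ) = r + l := ⟨i - l, by omega⟩
      have h1 : N - ((i : ℕ) + 1) = m := by omega
      have h2 : (i : ℕ) - l = r := by omega
      have h3 : N - (r + 1) = m + l := by omega
      have h4 : lam + (r + 1) - 1 = lam + r := by omega
      have hs : (μch N a ((i : ℕ) + 1) / μch N a (r + 1)) ^ 2 =
          (m + l).factorial / (a ^ l * m.factorial) := by
        rw [div_pow, sq_μch ha, sq_μch ha, h1, h3, hr]
        have := Nat.factorial_pos m
        have := Nat.factorial_pos (m + l)
        field_simp
        ring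
      have h5 : (i : ℕ) = (i : ℕ) - l + l := by omega
      simp only [if_pos h5]
      rw [h1, h2, mul_right_comm, Complex.star_def, Complex.conj_ofReal, ← pow_two,
        ← Complex.ofReal_pow (_ / _), hs, δch, h4, Nat.add_sub_cancel]
      have e1 := Nat.add_choose_mul_factorial_mul_factorial m l
      have e2 := Nat.add_choose_mul_factorial_mul_factorial lam r
      rw [← Nat.choose_symm_add] at e1 e2
      rw [← e1, ← e2]
      have := Nat.factorial_ne_zero m
      have := Nat.factorial_ne_zero l
      have := Nat.factorial_ne_zero r
      have f1 : (m.factorial : ℂ) ≠ 0 := by assumption_mod_cast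
      have f2 : (l.factorial : ℂ) ≠ 0 := by assumption_mod_cast
      have f3 : (r.factorial : ℂ) ≠ 0 := by assumption_mod_cast
      push_cast
      rw [smul_eq_mul]
      field_simp
    · intro j _ hj
      have : ¬ (i : ℕ) = j + l := fun h' => hj (Fin.ext (by simp; omega))
      simp [this]
    · simp
  · rw [Finset.sum_eq_zero, smul_zero]
    intro j _
    by_cases h1 : (i : ℕ) = j + l
    · have : ¬ (k : ℕ) = j + l := fun h2 => h ⟨Fin.ext (h1.trans h2.symm), by omega⟩
      simp [this]
    · simp [h1]

theorem Dch_zero (lam : ℕ) :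
    Dch N a 0 lam = Complex.exp a • Matrix.diagonal fun k : Fin N =>
      ((a : ℂ) / 2) ^ lam * lam.factorial * ((N + lam).choose k : ℂ) := by
  rw [Dch, ← Matrix.diagonal_smul]
  congr 1
  ext k
  obtain ⟨m, hm⟩ : ∃ m, N = (k : ℕ) + 1 + m := ⟨N - (k + 1), by omega⟩
  have h1 : N - ((k : ℕ) + 1) = m := by omega
  have h2 : N - (k : ℕ) = m + 1 := by omega
  have h3 : N + lam = k + (lam + m + 1) := by omega
  have p1 : (ascPochhammer ℂ ((k : ℕ) + 1)).eval (-((N : ℂ) + lam + (0 : ℕ))) =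
      (-1) ^ ((k : ℕ) + 1) * ((N + lam).descFactorial (k + 1) : ℂ) := by
    rw [ascPochhammer_eval_neg_eq_descPochhammer, ← descPochhammer_eval_eq_descFactorial]
    simp
  have p2 : (ascPochhammer ℂ (m + 1)).eval ((lam : ℂ) + (0 : ℕ) + 1) =
      ((lam + 1).ascFactorial (m + 1) : ℂ) := by
    rw [← ascPochhammer_nat_eq_ascFactorial, ascPochhammer_eval_cast]
    congr 1
    push_cast
    ring
  have e1 := Nat.factorial_mul_ascFactorial lam (m + 1)
  have e2 := Nat.factorial_mul_descFactorial (n := N + lam) (k := k + 1) (by omega)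
  have e3 := Nat.add_choose_mul_factorial_mul_factorial k (lam + m + 1)
  rw [← Nat.choose_symm_add, ← h3] at e3
  rw [show N + lam - (k + 1) = lam + m by omega] at e2
  rw [← add_assoc] at e1
  rw [h1, h2, p1, p2]
  simp only [Pi.smul_apply, smul_eq_mul]
  have f1 : (lam.factorial : ℂ) ≠ 0 := by exact_mod_cast lam.factorial_ne_zero
  have f2 : ((k : ℕ).factorial : ℂ) ≠ 0 := by exact_mod_cast (k : ℕ).factorial_ne_zero
  have f3 : ((lam + 1).ascFactorial (m + 1) : ℂ) ≠ 0 := by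
    exact_mod_cast (Nat.ascFactorial_pos _ _).ne'
  have e : ((lam + m).factorial : ℂ) * ((N + lam).descFactorial (k + 1) : ℂ) =
      ((N + lam).choose k : ℂ) * (k : ℕ).factorial *
        (lam.factorial * ((lam + 1).ascFactorial (m + 1) : ℂ)) := by
    exact_mod_cast e2.trans (e3.symm.trans (by rw [e1]))
  have hs : (-1 : ℂ) ^ ((k : ℕ) + 1) * (-1) ^ ((k : ℕ) + 1) = 1 := by
    rw [← mul_pow]
    simp
  rw [div_eq_iff f3, Nat.factorial_zero, pow_zero, Nat.cast_one, div_mul_eq_mul_div,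
    div_eq_iff f2]
  linear_combination (Complex.exp a * (a / 2) ^ lam) * e +
    (Complex.exp a * (a / 2) ^ lam * (lam + m).factorial *
      ((N + lam).descFactorial (k + 1) : ℂ)) * hs

theorem hasSum_smul_Amat_pow_mul_Tmat_mul (ha : 0 < a) (lam : ℕ) :
    HasSum (fun l : ℕ => ((a : ℂ) ^ l / l.factorial) • (Amat N (μch N a) ^ l *
        Tmat N (δch a lam) * (Amat N (μch N a))ᴴ ^ l))
      (Matrix.diagonal fun k : Fin N =>
        ((a : ℂ) / 2) ^ lam * lam.factorial * ((N + lam).choose k : ℂ)) := by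
  refine Pi.hasSum.2 fun i => Pi.hasSum.2 fun k => ?_
  simp only [smul_Amat_pow_mul_Tmat_mul_apply ha]
  by_cases h : i = k
  · subst h
    rw [Matrix.diagonal_apply_eq]
    have h1 : (N + lam).choose i = (N - (i + 1) + lam + 1 + i).choose (N - (i + 1) + lam + 1) := by
      rw [Nat.choose_symm_add]
      congr 1
      omega
    rw [h1, ← sum_choose_mul_choose, Nat.cast_sum, Finset.mul_sum]
    convert hasSum_sum_of_ne_finset_zero (s := Finset.range ((i : ℕ) + 1))
      (L := .unconditional ℕ) ?_ using 1
    · refine Finset.sum_congr rfl fun l hl => ?_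
      rw [if_pos ⟨rfl, Nat.lt_succ_iff.1 (Finset.mem_range.1 hl)⟩]
    · intro l hl
      rw [if_neg]
      rintro ⟨-, h⟩
      exact hl (Finset.mem_range.2 (Nat.lt_succ_iff.2 h))
  · simp only [h, false_and, if_false]
    rw [Matrix.diagonal_apply_ne _ h]
    exact hasSum_zero

open scoped Matrix.Norms.Operator in
theorem commute_one_add_pow_exp_smul (X : Mat N) (t : ℂ) (n : ℕ) :
    Commute ((1 + X) ^ n) (NormedSpace.exp (t • X)) :=
  (((Commute.one_left X).add_left (Commute.refl X)).smul_right t).exp_right.pow_left n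

theorem hasSum_Wch (ha : 0 < a) (lam : ℕ) :
    HasSum (Wch N a (μch N a) (δch a lam) lam)
      (NormedSpace.exp ((a : ℂ) • Amat N (μch N a)) * (1 + Amat N (μch N a)) ^ lam *
        Dch N a 0 lam * ((1 + (Amat N (μch N a))ᴴ) ^ lam *
          NormedSpace.exp ((a : ℂ) • (Amat N (μch N a))ᴴ))) := by
  have h := ((Matrix.hasSum_one_add_pow_mul_mul_one_add_pow (a : ℂ)
    (hasSum_smul_Amat_pow_mul_Tmat_mul (N := N) ha lam)).mul_left
      ((1 + Amat N (μch N a)) ^ lam)).mul_right ((1 + (Amat N (μch N a))ᴴ) ^ lam)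
  have hs := (commute_one_add_pow_exp_smul (Amat N (μch N a)) (a : ℂ) lam).eq
  have hs' := (commute_one_add_pow_exp_smul (Amat N (μch N a))ᴴ (a : ℂ) lam).eq
  rw [← hs, hs', Dch_zero]
  simp only [mul_smul_comm, smul_mul_assoc, mul_assoc] at h ⊢
  refine h.congr_fun fun x => ?_
  rw [Wch, pow_add (1 + (Amat N (μch N a))ᴴ), add_comm x lam, pow_add]
  simp only [mul_assoc]
  push_cast
  rfl

theorem innerN_Wch_zero (ha : 0 < a) (lam : ℕ) {P : ℕ → Polynomial (Mat N)}
    (hP : IsMOSN (Wch N a (μch N a) (δch a lam) lam) P) :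
    innerN (Wch N a (μch N a) (δch a lam) lam) (P 0) (P 0) =
      NormedSpace.exp ((a : ℂ) • Amat N (μch N a)) * (1 + Amat N (μch N a)) ^ lam *
        Dch N a 0 lam * ((1 + (Amat N (μch N a))ᴴ) ^ lam *
          NormedSpace.exp ((a : ℂ) • (Amat N (μch N a))ᴴ)) := by
  have h : P 0 = C 1 := by
    rw [C_1]
    exact (Polynomial.Monic.natDegree_eq_zero (hP.monic 0)).1 (hP.deg 0)
  rw [← (hasSum_Wch ha lam).tsum_eq, innerN]
  simp only [h, matEval_C, Matrix.conjTranspose_one, one_mul, mul_one]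

theorem innerN_Wch_eq (ha : 0 < a) {P : ℕ → ℕ → Polynomial (Mat N)}
    (hP : ∀ lam : ℕ, IsMOSN (Wch N a (μch N a) (δch a lam) lam) (P lam)) (n lam : ℕ) :
    innerN (Wch N a (μch N a) (δch a lam) lam) (P lam n) (P lam n) =
      NormedSpace.exp ((a : ℂ) • Amat N (μch N a)) * (1 + Amat N (μch N a)) ^ (n + lam) *
        Dch N a n lam * ((1 + (Amat N (μch N a))ᴴ) ^ (n + lam) *
          NormedSpace.exp ((a : ℂ) • (Amat N (μch N a))ᴴ)) := by
  have hV : IsUnit (1 + (Amat N (μch N a))ᴴ) := by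
    simpa [Matrix.star_eq_conjTranspose] using (isUnit_one_add_Amat (N := N) (μch N a)).star
  have hV' := (Matrix.isUnit_iff_isUnit_det _).1 hV
  obtain ⟨Z, hZ, hZ'⟩ : ∃ Z : Mat N, (1 + (Amat N (μch N a))ᴴ) * Z = (Amat N (μch N a))ᴴ ∧
      Z * (1 + (Amat N (μch N a))ᴴ) = (Amat N (μch N a))ᴴ := by
    refine ⟨1 - (1 + (Amat N (μch N a))ᴴ)⁻¹, ?_, ?_⟩
    · rw [mul_sub, Matrix.mul_nonsing_inv _ hV']
      simp
    · rw [sub_mul, Matrix.nonsing_inv_mul _ hV']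
      simp
  induction n generalizing lam with
  | zero => simpa using innerN_Wch_zero ha lam (hP lam)
  | succ n ih =>
    have hM : IsUnit ((1 + (Amat N (μch N a))ᴴ) ^ (n + 1 + lam) *
        NormedSpace.exp ((a : ℂ) • (Amat N (μch N a))ᴴ)) :=
      (hV.pow _).mul (Matrix.isUnit_exp _)
    have hD : IsUnit ((1 / 2 : ℂ) • (((lam : ℂ) + N + 1) • 1 - Jdiag N)) := by
      have hd : (1 / 2 : ℂ) • (((lam : ℂ) + N + 1) • (1 : Mat N) - Jdiag N) =
          Matrix.diagonal fun i : Fin N => (1 / 2 : ℂ) * ((lam + (N - i) : ℕ) : ℂ) := by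
        ext i k
        by_cases hik : i = k
        · subst hik
          simp [Jdiag]
          ring
        · simp [Jdiag, hik]
      rw [hd, Matrix.isUnit_diagonal, Pi.isUnit_iff]
      intro i
      have : lam + (N - i) ≠ 0 := by omega
      exact (mul_ne_zero (by norm_num) (Nat.cast_ne_zero.2 this)).isUnit
    have h := innerN_Wch_succ_mul ha lam hZ hZ' (hP lam) (hP (lam + 1)) n
    have hJ := Jdiag_mul_one_add_pow_mul_exp (μch N a) hZ hZ' (a : ℂ) (n + 1 + lam)
    have hG : ((1 + (Amat N (μch N a))ᴴ) ^ (n + 1 + lam) *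
        NormedSpace.exp ((a : ℂ) • (Amat N (μch N a))ᴴ)) *
          ((1 / 2 : ℂ) • (((lam : ℂ) + N + 1) • 1 - (Jdiag N - (a : ℂ) • (Amat N (μch N a))ᴴ -
          ((n + 1 + lam : ℕ) : ℂ) • Z))) =
        ((1 / 2 : ℂ) • (((lam : ℂ) + N + 1) • 1 - Jdiag N)) *
          ((1 + (Amat N (μch N a))ᴴ) ^ (n + 1 + lam) *
            NormedSpace.exp ((a : ℂ) • (Amat N (μch N a))ᴴ)) := by
      rw [mul_smul_comm, mul_sub, ← hJ, smul_mul_assoc, sub_mul, mul_smul_comm, smul_mul_assoc,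
        mul_one, one_mul]
    have hGu := hD.mul hM
    rw [← hG] at hGu
    have hGu' : IsUnit ((1 / 2 : ℂ) • (((lam : ℂ) + N + 1) • 1 - (Jdiag N -
        (a : ℂ) • (Amat N (μch N a))ᴴ - ((n + 1 + lam : ℕ) : ℂ) • Z))) := by
      obtain ⟨u, hu⟩ := hM
      rw [← hu] at hGu
      exact u.isUnit_units_mul _ |>.1 hGu
    rw [← hGu'.mul_left_inj, h, ih (lam + 1), mul_assoc _ _ (_ • _), hG, ← mul_assoc _ (_ • _),
      mul_assoc _ (Dch N a (n + 1) lam), Dch_succ_mul, show n + (lam + 1) = n + 1 + lam by ring]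
    simp only [mul_smul_comm, smul_mul_assoc]

end CharlierNorms

/-- the LDU decomposition of the squared norms of the monic matrix
Charlier polynomials for the specific parameters. -/
theorem charlier_norms_LDU (N : ℕ) (hN : 1 ≤ N) (a : ℝ) (ha : 0 < a)
    (P : ℕ → ℕ → Polynomial (Mat N))
    (hP : ∀ lam : ℕ, IsMOSN (Wch N a (μch N a) (δch a lam) lam) (P lam))
    (H : ℕ → ℕ → Mat N)
    (hH : ∀ lam n : ℕ,
      H lam n = innerN (Wch N a (μch N a) (δch a lam) lam) (P lam n) (P lam n)) :
    ∀ n lam : ℕ,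
      H lam n = (Lmat N a (μch N a) 0)⁻¹ * (1 + Amat N (μch N a)) ^ (n + lam)
          * Dch N a n lam * (1 + (Amat N (μch N a))ᴴ) ^ (n + lam)
          * ((Lmat N a (μch N a) 0)ᴴ)⁻¹ := by
  intro n lam
  have hμ := μch_ne_zero (N := N) ha
  rw [hH, inv_Lmat_zero hμ, inv_conjTranspose_Lmat_zero hμ, innerN_Wch_eq ha hP]
  simp only [mul_assoc]
end
end
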